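/- Let A be an odd positive definite unimodular lattice of rank 24 with no vectors of norm 1, let A₂ = {x ∈ A : B(x,x) even} be its even sublattice, and let B₁ ≠ B₂ be the two even neighbors of A: even unimodular lattices inside A ⊗ ℚ (finitely generated ℤ-submodules spanning A ⊗ ℚ on which the extended bilinear form is ℤ-valued, even, and unimodular) each containing A₂. Let hᵢ = |{r ∈ Bᵢ : B(r,r) = 2}|/24 be their Coxeter numbers and let ρ ∈ A ⊗ ℚ be the Weyl vector of A relative to a ℚ-linear functional nonvanishing on the roots of A. Then B(ρ, ρ) = h₁·h₂, and the number of roots of A is 8(h₁ + h₂ − 2). -/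

import Mathlib

section ModularForms

open UpperHalfPlane ModularForm Filter Topology
open scoped MatrixGroups Manifold

theorem tendsto_atImInfty_of_tendsto_sub_div_qParam {F : ℍ → ℂ} {c₀ c₁ : ℂ}
    (h : Tendsto (fun τ : ℍ => (F τ - c₀) / Function.Periodic.qParam 1 τ) atImInfty (𝓝 c₁)) :
    Tendsto F atImInfty (𝓝 c₀) := by
  have hq := qParam_tendsto_atImInfty (h := 1) one_pos
  have := (h.mul hq).add_const c₀
  simp only [mul_zero, zero_add] at this
  refine this.congr fun τ => ?_
  rw [div_mul_cancel₀ _ (Function.Periodic.qParam_ne_zero _), sub_add_cancel]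

/-- If the space of level one modular forms of weight `k` is a line, then the first two Fourier
coefficients are proportional to those of the normalised Eisenstein series. -/
theorem levelOne_coeff_one_of_finrank_eq_one {k : ℕ} (hk : 3 ≤ k) (hev : Even k)
    (hrank : Module.finrank ℂ (ModularForm 𝒮ℒ (k : ℤ)) = 1) {F : ℍ → ℂ} {c₀ c₁ : ℂ}
    (hhol : MDiff F) (hS : F ∣[(k : ℤ)] ModularGroup.S = F)
    (hT : F ∣[(k : ℤ)] ModularGroup.T = F)
    (h : Tendsto (fun τ : ℍ => (F τ - c₀) / Function.Periodic.qParam 1 τ) atImInfty (𝓝 c₁)) :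
    c₁ = -(2 * k / bernoulli k) * c₀ := by
  have hF := tendsto_atImInfty_of_tendsto_sub_div_qParam h
  have hslash := SlashInvariantForm.slash_action_generators_SL2Z hS hT
  obtain ⟨f, hf⟩ : ∃ f : ModularForm 𝒮ℒ (k : ℤ), ⇑f = F := ⟨
    { toFun := F
      slash_action_eq' := fun _ ⟨γ, hγ⟩ => hγ ▸ hslash γ
      holo' := hhol
      bdd_at_cusps' {c} hc := by
        rw [OnePoint.isBoundedAt_iff_forall_SL2Z hc]
        intro γ _
        have : F ∣[(k : ℤ)] γ = F := hslash γ
        change IsBoundedAtImInfty (F ∣[(k : ℤ)] γ)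
        rw [this]
        exact hF.isBigO_one ℝ }, rfl⟩
  obtain ⟨c, hc⟩ := (finrank_eq_one_iff_of_nonzero' (E hk) (EisensteinSeries.E_ne_zero hk hev)).mp
    hrank f
  have hcoef : ∀ m, (qExpansion 1 F).coeff m = c * (qExpansion 1 (E hk)).coeff m := by
    intro m
    have : qExpansion 1 F = c • qExpansion 1 (E hk) := by
      rw [← ModularForm.qExpansion_smul one_pos one_mem_strictPeriods_SL c (E hk), ← hf, ← hc]
      rfl
    rw [this]; simp
  have h0 : (qExpansion 1 F).coeff 0 = c := by
    rw [hcoef, EisensteinSeries.E_qExpansion_coeff_zero hk hev, mul_one]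
  have h1 : (qExpansion 1 F).coeff 1 = -(2 * k / bernoulli k) * c := by
    rw [hcoef, EisensteinSeries.E_qExpansion_coeff hk hev]
    simp
    ring
  have hper : Function.Periodic (F ∘ ofComplex) (1 : ℝ) := by
    rw [← hf]
    exact SlashInvariantFormClass.periodic_comp_ofComplex f one_mem_strictPeriods_SL
  have han : AnalyticAt ℂ (cuspFunction 1 F) 0 :=
    analyticAt_cuspFunction_zero one_pos hper hhol (hF.isBigO_one ℝ)
  have hz : cuspFunction 1 F 0 = c₀ := by
    rw [cuspFunction_apply_zero one_pos han hper]; exact hF.limUnder_eq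
  have hc0 : c₀ = c := by
    rw [← h0, ← hz]
    simp [qExpansion_coeff]
  have hd : HasDerivAt (cuspFunction 1 F) ((qExpansion 1 F).coeff 1) 0 := by
    have := han.differentiableAt.hasDerivAt
    simpa [qExpansion_coeff, iteratedDeriv_one] using this
  have hq : Tendsto (fun τ : ℍ => Function.Periodic.qParam 1 τ) atImInfty (𝓝[≠] 0) :=
    tendsto_nhdsWithin_iff.mpr ⟨qParam_tendsto_atImInfty one_pos,
      Eventually.of_forall fun τ => Function.Periodic.qParam_ne_zero _⟩
  have ht := (hasDerivAt_iff_tendsto_slope.mp hd).comp hq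
  have : c₁ = (qExpansion 1 F).coeff 1 := by
    refine tendsto_nhds_unique h (ht.congr fun τ => ?_)
    simp only [Function.comp, slope_def_field, sub_zero, hz]
    rw [eq_cuspFunction τ one_ne_zero hper]
  rw [this, h1, hc0]

theorem levelOne_weight_fourteen_coeff_one {F : ℍ → ℂ} {c₀ c₁ : ℂ}
    (hhol : MDiff F) (hS : F ∣[(14 : ℤ)] ModularGroup.S = F)
    (hT : F ∣[(14 : ℤ)] ModularGroup.T = F)
    (h : Tendsto (fun τ : ℍ => (F τ - c₀) / Function.Periodic.qParam 1 τ) atImInfty (𝓝 c₁)) :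
    c₁ = -24 * c₀ := by
  have hev : Even 14 := ⟨7, rfl⟩
  have hrank : Module.finrank ℂ (ModularForm 𝒮ℒ ((14 : ℕ) : ℤ)) = 1 := by
    rw [← Module.rank_eq_one_iff_finrank_eq_one, dimension_level_one 14 hev]
    rw [if_pos (by decide)]
    norm_num
  rw [levelOne_coeff_one_of_finrank_eq_one (k := 14) (by norm_num) hev hrank hhol hS hT h]
  have : bernoulli 14 = 7 / 6 := by decide +kernel
  rw [this]
  norm_num

end ModularForms

section ExponentialSeries

open UpperHalfPlane hiding I
open Filter Topology Complex
open scoped Manifold Real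

variable {X : Type*} {w : X → ℂ} {Q : X → ℝ}

theorem norm_cexp_pi_I_mul_mul (t : ℝ) (z : ℂ) :
    ‖cexp (π * I * t * z)‖ = rexp (-π * z.im * t) := by
  rw [Complex.norm_exp]
  congr 1
  simp
  ring

theorem norm_mul_cexp_le_of_le_im (hQ : ∀ x, 0 ≤ Q x) {ε : ℝ} {z : ℂ} (hz : ε ≤ z.im) (x : X) :
    ‖w x * cexp (π * I * Q x * z)‖ ≤ ‖w x‖ * rexp (-π * ε * Q x) := by
  rw [norm_mul, norm_cexp_pi_I_mul_mul]
  gcongr ?_ * rexp ?_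
  have := mul_le_mul_of_nonneg_right hz (hQ x)
  nlinarith [Real.pi_pos]

theorem summable_mul_cexp (hQ : ∀ x, 0 ≤ Q x)
    (hs : ∀ ε > 0, Summable fun x => ‖w x‖ * rexp (-π * ε * Q x)) {z : ℂ} (hz : 0 < z.im) :
    Summable fun x => w x * cexp (π * I * Q x * z) :=
  (hs z.im hz).of_norm_bounded fun x => norm_mul_cexp_le_of_le_im hQ le_rfl x

theorem mdifferentiable_tsum_mul_cexp (hQ : ∀ x, 0 ≤ Q x)
    (hs : ∀ ε > 0, Summable fun x => ‖w x‖ * rexp (-π * ε * Q x)) :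
    MDiff (fun τ : ℍ => ∑' x, w x * cexp (π * I * Q x * τ)) := by
  have key : DifferentiableOn ℂ (fun z : ℂ => ∑' x, w x * cexp (π * I * Q x * z))
      {z | 0 < z.im} := by
    intro z₀ hz₀
    have hz₀ : 0 < z₀.im := hz₀
    have hopen : IsOpen {z : ℂ | z₀.im / 2 < z.im} := isOpen_lt continuous_const continuous_im
    have := differentiableOn_tsum_of_summable_norm (hs (z₀.im / 2) (by positivity))
      (F := fun x z => w x * cexp (π * I * Q x * z)) (fun x => by fun_prop) hopen
      (fun x z hz => norm_mul_cexp_le_of_le_im hQ (le_of_lt hz) x)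
    exact (this.differentiableAt (hopen.mem_nhds (by simpa using hz₀))).differentiableWithinAt
  rw [UpperHalfPlane.mdifferentiable_iff]
  refine key.congr fun z hz => ?_
  simp only [Function.comp]
  rw [ofComplex_apply_of_im_pos hz]

theorem tendsto_cexp_atImInfty {t : ℝ} (ht : 0 < t) :
    Tendsto (fun τ : ℍ => cexp (π * I * t * τ)) atImInfty (𝓝 0) := by
  rw [tendsto_zero_iff_norm_tendsto_zero]
  simp only [norm_cexp_pi_I_mul_mul, coe_im]
  have h1 : Tendsto (fun τ : ℍ => (π * t) * τ.im) atImInfty atTop :=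
    (tendsto_comap.const_mul_atTop (by positivity))
  refine (Real.tendsto_exp_neg_atTop_nhds_zero.comp h1).congr fun τ => ?_
  simp only [Function.comp]
  congr 1; ring

theorem qParam_one_eq (z : ℂ) : Function.Periodic.qParam 1 z = cexp (π * I * (2 : ℝ) * z) := by
  rw [Function.Periodic.qParam]
  congr 1; push_cast; ring

/-- The first coefficients of an exponential series with exponents in `{0, 2} ∪ [3, ∞)`. -/
theorem tendsto_tsum_sub_div_qParam (hQ : ∀ x, Q x = 0 ∨ Q x = 2 ∨ 3 ≤ Q x)
    (hs : ∀ ε > 0, Summable fun x => ‖w x‖ * rexp (-π * ε * Q x)) :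
    Tendsto (fun τ : ℍ => ((∑' x, w x * cexp (π * I * Q x * τ)) -
        ∑' x, if Q x = 0 then w x else 0) / Function.Periodic.qParam 1 τ) atImInfty
      (𝓝 (∑' x, if Q x = 2 then w x else 0)) := by
  have hQ0 : ∀ x, 0 ≤ Q x := fun x => by rcases hQ x with h | h | h <;> linarith
  have hs0 : Summable fun x => if Q x = 0 then w x else 0 := by
    refine (hs 1 one_pos).of_norm_bounded fun x => ?_
    split_ifs with h
    · simp [h]
    · simp; positivity
  let g : ℍ → X → ℂ := fun τ x =>
    (w x * cexp (π * I * Q x * τ) - if Q x = 0 then w x else 0) / Function.Periodic.qParam 1 τ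
  have hg : ∀ τ x, Q x ≠ 0 → g τ x = w x * cexp (π * I * (Q x - 2 : ℝ) * τ) := by
    intro τ x h
    simp only [g, if_neg h, sub_zero, qParam_one_eq]
    rw [mul_div_assoc, ← Complex.exp_sub]
    congr 2; push_cast; ring
  have hlim : Tendsto (fun τ => ∑' x, g τ x) atImInfty
      (𝓝 (∑' x, if Q x = 2 then w x else 0)) := by
    refine tendsto_tsum_of_dominated_convergence
      (bound := fun x => ‖w x‖ * rexp (-π * (1 / 3) * Q x) * rexp π) ?_ ?_ ?_
    · exact (hs (1/3) (by norm_num)).mul_right _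
    · intro x
      rcases hQ x with h | h | h
      · simp [g, h]
      · refine tendsto_const_nhds.congr fun τ => ?_
        rw [hg τ x (by rw [h]; norm_num), h]
        simp
      · rw [if_neg (by linarith)]
        have := (tendsto_cexp_atImInfty (t := Q x - 2) (by linarith)).const_mul (w x)
        rw [mul_zero] at this
        refine this.congr fun τ => ?_
        rw [hg τ x (by linarith)]
    · have : ∀ᶠ τ : ℍ in atImInfty, 1 ≤ τ.im := by
        rw [eventually_iff, atImInfty_mem]
        exact ⟨1, fun _ h => h⟩
      filter_upwards [this] with τ hτ x
      rcases hQ x with h | h | h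
      · simp [g, h]; positivity
      · rw [hg τ x (by rw [h]; norm_num), h]
        simp only [sub_self, ofReal_zero, mul_zero, zero_mul, Complex.exp_zero, mul_one]
        rw [mul_assoc, ← Real.exp_add]
        refine le_mul_of_one_le_right (norm_nonneg _) (Real.one_le_exp ?_)
        nlinarith [Real.pi_pos]
      · rw [hg τ x (by linarith), norm_mul, norm_cexp_pi_I_mul_mul, mul_assoc ‖w x‖, ← Real.exp_add]
        gcongr ?_ * rexp ?_
        rw [coe_im]
        have h1 : (1 : ℝ) * (Q x - 2) ≤ τ.im * (Q x - 2) :=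
          mul_le_mul_of_nonneg_right hτ (by linarith)
        nlinarith [Real.pi_pos]
  refine hlim.congr fun τ => ?_
  have h1 := summable_mul_cexp hQ0 hs τ.im_pos
  simp only [g]
  rw [← h1.tsum_sub hs0, tsum_div_const]

end ExponentialSeries

section Poisson

open MeasureTheory Complex Set Filter Topology
open scoped Real

variable {ι : Type*} [Fintype ι]

theorem summable_pi_prod_of_nonneg {β : Type*} {g : β → ℝ} (hg0 : ∀ b, 0 ≤ g b)
    (hg : Summable g) : Summable fun x : ι → β => ∏ i, g (x i) := by
  classical
  refine summable_of_sum_le (c := (∑' b, g b) ^ Fintype.card ι)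
    (fun x => Finset.prod_nonneg fun i _ => hg0 _) fun s => ?_
  let t : Finset β := s.biUnion fun x => Finset.univ.image x
  have hst : s ⊆ Fintype.piFinset fun _ : ι => t := by
    intro x hx
    rw [Fintype.mem_piFinset]
    intro i
    exact Finset.mem_biUnion.mpr ⟨x, hx, Finset.mem_image_of_mem _ (Finset.mem_univ _)⟩
  calc ∑ x ∈ s, ∏ i, g (x i) ≤ ∑ x ∈ Fintype.piFinset fun _ : ι => t, ∏ i, g (x i) :=
        Finset.sum_le_sum_of_subset_of_nonneg hst fun x _ _ => Finset.prod_nonneg fun i _ => hg0 _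
    _ = ∏ _i : ι, ∑ b ∈ t, g b := (Finset.prod_univ_sum (fun _ => t) fun _ b => g b).symm
    _ = (∑ b ∈ t, g b) ^ Fintype.card ι := by simp
    _ ≤ _ := pow_le_pow_left₀ (Finset.sum_nonneg fun b _ => hg0 b)
        (hg.sum_le_tsum t fun b _ => hg0 b) _

theorem summable_exp_neg_mul_sum_sq {ε : ℝ} (hε : 0 < ε) :
    Summable fun x : ι → ℤ => rexp (-ε * ∑ i, (x i : ℝ) ^ 2) := by
  have h1 : Summable fun n : ℤ => rexp (-ε * (n : ℝ) ^ 2) := by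
    have := summable_pow_mul_jacobiTheta₂_term_bound 0 (T := ε / π) (by positivity) 0
    refine this.congr fun n => ?_
    simp
    field_simp
  refine (summable_pi_prod_of_nonneg (fun n => (Real.exp_pos _).le) h1).congr fun x => ?_
  rw [← Real.exp_sum, Finset.mul_sum]

/-- Integration over `ℝⁿ` unfolds to a sum over the integer translates of the unit cube. -/
theorem hasSum_setIntegral_cube {f : (ι → ℝ) → ℂ} (hf : Integrable f) :
    HasSum (fun x : ι → ℤ =>
      ∫ y in {y : ι → ℝ | ∀ i, y i ∈ Ioc ((0 : ι → ℝ) i) ((0 : ι → ℝ) i + 1)},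
        f (fun i => y i + x i)) (∫ y, f y) := by
  let s : (ι → ℤ) → Set (ι → ℝ) := fun x => Set.pi univ fun i => Ioc (x i : ℝ) (x i + 1)
  have hU : ⋃ x, s x = univ := by
    refine eq_univ_of_forall fun y => mem_iUnion.mpr ?_
    have : ∀ i, ∃ n : ℤ, y i ∈ Ioc (n : ℝ) (n + 1) := fun i => by
      have := (iUnion_Ioc_intCast ℝ).symm ▸ mem_univ (y i)
      exact mem_iUnion.mp this
    choose x hx using this
    exact ⟨x, fun i _ => hx i⟩
  have hd : Pairwise (Function.onFun Disjoint s) := by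
    intro x x' hne
    obtain ⟨i, hi⟩ := Function.ne_iff.mp hne
    exact Set.disjoint_univ_pi.mpr ⟨i, pairwise_disjoint_Ioc_intCast ℝ hi⟩
  have := hasSum_integral_iUnion (μ := volume) (f := f) (s := s)
    (fun x => MeasurableSet.univ_pi fun i => measurableSet_Ioc) hd hf.integrableOn
  rw [hU, setIntegral_univ] at this
  refine this.congr_fun fun x => ?_
  have hmp : MeasurePreserving (fun y : ι → ℝ => y + fun i => (x i : ℝ)) volume volume :=
    measurePreserving_add_right volume _
  rw [← hmp.setIntegral_preimage_emb (measurableEmbedding_addRight _) f (s x)]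
  congr 2
  ext y
  simp only [s, Set.mem_pi, mem_preimage, Pi.add_apply, mem_Ioc, mem_univ, true_implies,
    mem_ofPred_eq, Pi.zero_apply]
  refine forall_congr' fun i => ⟨fun h => ⟨by linarith, by linarith⟩,
    fun h => ⟨by linarith, by linarith⟩⟩

theorem continuous_tsum_of_locally_bounded {f : (ι → ℝ) → ℂ} (hf : Continuous f)
    (hbd : ∀ R : ℝ, ∃ u : (ι → ℤ) → ℝ, Summable u ∧
      ∀ (x : ι → ℤ) (y : ι → ℝ), ‖y‖ ≤ R → ‖f (fun i => y i + x i)‖ ≤ u x) :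
    Continuous fun y : ι → ℝ => ∑' x : ι → ℤ, f (fun i => y i + x i) := by
  rw [continuous_iff_continuousAt]
  intro y₀
  obtain ⟨u, hu, hb⟩ := hbd (‖y₀‖ + 1)
  have : ContinuousOn (fun y : ι → ℝ => ∑' x : ι → ℤ, f (fun i => y i + x i))
      (Metric.ball 0 (‖y₀‖ + 1)) :=
    continuousOn_tsum (fun x => by fun_prop) hu fun x y hy =>
      hb x y (mem_ball_zero_iff.mp hy).le
  exact this.continuousAt (Metric.isOpen_ball.mem_nhds (by simp))

/-- The Poisson summation formula on `ℝⁿ`. -/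
theorem tsum_eq_tsum_integral {f : (ι → ℝ) → ℂ} (hf : Continuous f) (hfi : Integrable f)
    (hbd : ∀ R : ℝ, ∃ u : (ι → ℤ) → ℝ, Summable u ∧
      ∀ (x : ι → ℤ) (y : ι → ℝ), ‖y‖ ≤ R → ‖f (fun i => y i + x i)‖ ≤ u x)
    (hsum : Summable fun m : ι → ℤ =>
      ∫ y : ι → ℝ, cexp (-(2 * π * I * ∑ i, (m i : ℂ) * y i)) * f y) :
    ∑' x : ι → ℤ, f (fun i => x i) =
      ∑' m : ι → ℤ, ∫ y : ι → ℝ, cexp (-(2 * π * I * ∑ i, (m i : ℂ) * y i)) * f y := by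
  let F : C(ι → ℝ, ℂ) := ⟨fun y => ∑' x : ι → ℤ, f (fun i => y i + x i),
    continuous_tsum_of_locally_bounded hf hbd⟩
  have hq : IsOpenQuotientMap (Pi.map fun (_ : ι) (t : ℝ) => (t : UnitAddCircle)) :=
    IsOpenQuotientMap.piMap fun _ => QuotientAddGroup.isOpenQuotientMap_mk
  let q : C(ι → ℝ, UnitAddTorus ι) := ⟨_, hq.continuous⟩
  have hfac : Function.FactorsThrough F q := by
    intro y y' hyy
    have : ∀ i, ∃ n : ℤ, (n : ℝ) = -y i + y' i := fun i => by
      obtain ⟨n, hn⟩ := AddSubgroup.mem_zmultiples_iff.mp (QuotientAddGroup.eq.mp (congrFun hyy i))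
      exact ⟨n, by simpa using hn⟩
    choose n hn using this
    simp only [F, ContinuousMap.coe_mk]
    rw [← (Equiv.addRight n).tsum_eq]
    refine tsum_congr fun x => congrArg f (funext fun i => ?_)
    simp [hn]
    ring
  let G : C(UnitAddTorus ι, ℂ) := Topology.IsQuotientMap.lift (f := q) hq.isQuotientMap F hfac
  have hG : ∀ y : ι → ℝ, G (fun i => (y i : UnitAddCircle)) = F y := fun y =>
    DFunLike.congr_fun (Topology.IsQuotientMap.lift_comp (f := q) hq.isQuotientMap F hfac) y
  have hcoef : UnitAddTorus.mFourierCoeff G =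
      fun m => ∫ y : ι → ℝ, cexp (-(2 * π * I * ∑ i, (m i : ℂ) * y i)) * f y := by
    funext m
    rw [UnitAddTorus.mFourierCoeff_eq_integral _ _ 0]
    have hmF : ∀ y : ι → ℝ, UnitAddTorus.mFourier (-m) (fun i => (y i : UnitAddCircle)) =
        cexp (-(2 * π * I * ∑ i, (m i : ℂ) * y i)) := by
      intro y
      simp only [UnitAddTorus.mFourier, ContinuousMap.coe_mk, fourier_coe_apply]
      rw [← Complex.exp_sum, Finset.mul_sum, ← Finset.sum_neg_distrib]
      congr 1
      refine Finset.sum_congr rfl fun i _ => ?_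
      simp
      ring
    have hnorm : ∀ y : ι → ℝ, ‖cexp (-(2 * π * I * ∑ i, (m i : ℂ) * y i))‖ = 1 := by
      intro y
      rw [← Complex.norm_exp_ofReal_mul_I (-(2 * π * ∑ i, m i * y i))]
      congr 2; push_cast; ring
    have hcont : Continuous fun y : ι → ℝ => cexp (-(2 * π * I * ∑ i, (m i : ℂ) * y i)) := by
      fun_prop
    simp only [hmF, hG, smul_eq_mul]
    have hi : Integrable fun y : ι → ℝ => cexp (-(2 * π * I * ∑ i, (m i : ℂ) * y i)) * f y :=
      hfi.bdd_mul hcont.aestronglyMeasurable (c := 1) (.of_forall fun y => (hnorm y).le)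
    have hphase : ∀ (x : ι → ℤ) (y : ι → ℝ),
        cexp (-(2 * π * I * ∑ i, (m i : ℂ) * (y i + x i : ℝ))) =
        cexp (-(2 * π * I * ∑ i, (m i : ℂ) * y i)) := by
      intro x y
      rw [Complex.exp_eq_exp_iff_exists_int]
      refine ⟨-∑ i, m i * x i, ?_⟩
      push_cast
      simp only [mul_add, Finset.sum_add_distrib]
      ring
    have h1 := hasSum_setIntegral_cube hi
    rw [← h1.tsum_eq]
    simp only [hphase]
    obtain ⟨u, hu, hb⟩ := hbd 1
    have hfin : IsFiniteMeasure (volume.restrict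
        {y : ι → ℝ | ∀ i, y i ∈ Ioc ((0 : ι → ℝ) i) ((0 : ι → ℝ) i + 1)}) := by
      refine ⟨?_⟩
      rw [Measure.restrict_apply_univ]
      have : {y : ι → ℝ | ∀ i, y i ∈ Ioc ((0 : ι → ℝ) i) ((0 : ι → ℝ) i + 1)} ⊆
          Metric.closedBall 0 1 := fun y hy => by
        rw [mem_closedBall_zero_iff, pi_norm_le_iff_of_nonneg zero_le_one]
        intro i
        have := hy i
        simp only [Pi.zero_apply, zero_add, mem_Ioc] at this
        rw [Real.norm_of_nonneg this.1.le]; exact this.2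
      exact (measure_mono this).trans_lt measure_closedBall_lt_top
    have hmeas : MeasurableSet
        {y : ι → ℝ | ∀ i, y i ∈ Ioc ((0 : ι → ℝ) i) ((0 : ι → ℝ) i + 1)} :=
      MeasurableSet.univ_pi' fun i => measurableSet_Ioc
    have hb' : ∀ x : ι → ℤ, ∀ y ∈ {y : ι → ℝ | ∀ i, y i ∈ Ioc ((0 : ι → ℝ) i)
        ((0 : ι → ℝ) i + 1)}, ‖cexp (-(2 * π * I * ∑ i, (m i : ℂ) * y i)) *
          f (fun i => y i + x i)‖ ≤ u x := by
      intro x y hy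
      rw [norm_mul, hnorm, one_mul]
      refine hb x y ?_
      rw [pi_norm_le_iff_of_nonneg zero_le_one]
      intro i
      have := hy i
      simp only [Pi.zero_apply, zero_add, mem_Ioc] at this
      rw [Real.norm_of_nonneg this.1.le]; exact this.2
    refine (HasSum.tsum_eq (hasSum_integral_of_dominated_convergence (fun x _ => u x) ?_ ?_ ?_ ?_
      ?_)).symm
    · intro x
      exact (hcont.mul (by fun_prop)).aestronglyMeasurable
    · intro x
      exact (ae_restrict_iff' hmeas).mpr (.of_forall fun y hy => hb' x y hy)
    · exact .of_forall fun _ => hu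
    · exact integrable_const _
    · refine (ae_restrict_iff' hmeas).mpr (.of_forall fun y hy => ?_)
      have : Summable fun x : ι → ℤ => cexp (-(2 * π * I * ∑ i, (m i : ℂ) * y i)) *
          f (fun i => y i + x i) := hu.of_norm_bounded fun x => hb' x y hy
      have h2 := this.hasSum
      rwa [tsum_mul_left] at h2
  have h := UnitAddTorus.hasSum_mFourier_series_apply_of_summable (f := G) (by rwa [hcoef]) 0
  have h0 : G 0 = F 0 := hG 0
  rw [hcoef, h0] at h
  have hone : ∀ m : ι → ℤ, UnitAddTorus.mFourier m (0 : UnitAddTorus ι) = 1 := fun m => by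
    simp [UnitAddTorus.mFourier]
  simp only [hone, smul_eq_mul, mul_one] at h
  rw [h.tsum_eq]
  simp [F]

end Poisson

section GaussianPoisson

open MeasureTheory Complex Set Filter Topology Matrix
open scoped Real

theorem norm_cexp_mul_sum_sq {ι : Type*} [Fintype ι] (τ : ℂ) (v : ι → ℝ) :
    ‖cexp (π * I * τ * ∑ i, (v i : ℂ) ^ 2)‖ = rexp (-(π * τ.im * ∑ i, v i ^ 2)) := by
  have h : ∑ i, (v i : ℂ) ^ 2 = ((∑ i, v i ^ 2 : ℝ) : ℂ) := by push_cast; rfl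
  rw [Complex.norm_exp, h, re_mul_ofReal]
  simp

variable {ι : Type*} [Fintype ι] [DecidableEq ι]

theorem exists_mul_sum_sq_le {M : Matrix ι ι ℝ} (hM : M.det ≠ 0) :
    ∃ c > 0, ∀ y : ι → ℝ, c * ∑ i, y i ^ 2 ≤ ∑ i, (M *ᵥ y) i ^ 2 := by
  let K : ℝ := 1 + ∑ i, ∑ j, M⁻¹ i j ^ 2
  have hK : 0 < K := by positivity
  refine ⟨K⁻¹, inv_pos.mpr hK, fun y => ?_⟩
  rw [inv_mul_le_iff₀ hK]
  have h1 : ∀ i, y i = ∑ j, M⁻¹ i j * (M *ᵥ y) j := fun i => by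
    have : M⁻¹ *ᵥ (M *ᵥ y) = y := by
      rw [mulVec_mulVec, nonsing_inv_mul _ (isUnit_iff_ne_zero.mpr hM), one_mulVec]
    exact (congrFun this i).symm
  calc ∑ i, y i ^ 2 ≤ ∑ i, (∑ j, M⁻¹ i j ^ 2) * ∑ j, (M *ᵥ y) j ^ 2 := by
        refine Finset.sum_le_sum fun i _ => ?_
        conv_lhs => rw [h1 i]
        exact Finset.sum_mul_sq_le_sq_mul_sq _ _ _
    _ = (∑ i, ∑ j, M⁻¹ i j ^ 2) * ∑ j, (M *ᵥ y) j ^ 2 := by rw [Finset.sum_mul]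
    _ ≤ K * ∑ j, (M *ᵥ y) j ^ 2 := by
        refine mul_le_mul_of_nonneg_right ?_ (by positivity)
        simp [K]

theorem summable_exp_neg_mul_sum_mulVec_sq {M : Matrix ι ι ℝ} (hM : M.det ≠ 0) {ε : ℝ}
    (hε : 0 < ε) :
    Summable fun x : ι → ℤ => rexp (-ε * ∑ i, (M *ᵥ fun j => (x j : ℝ)) i ^ 2) := by
  obtain ⟨c, hc, h⟩ := exists_mul_sum_sq_le hM
  refine (summable_exp_neg_mul_sum_sq (ι := ι) (mul_pos hε hc)).of_nonneg_of_le
    (fun x => (Real.exp_pos _).le) fun x => Real.exp_le_exp.mpr ?_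
  have := mul_le_mul_of_nonneg_left (h fun j => x j) hε.le
  linarith

theorem integral_gaussian_mulVec {M : Matrix ι ι ℝ} (hM : |M.det| = 1) {τ : ℂ} (hτ : 0 < τ.im)
    (a n : ι → ℝ) :
    Integrable (fun y : ι → ℝ => cexp (π * I * τ * ∑ i, ((M *ᵥ (y + a)) i : ℂ) ^ 2)) ∧
    ∫ y : ι → ℝ, cexp (-(2 * π * I * ∑ i, ((M *ᵥ n) i : ℂ) * (M *ᵥ y) i)) *
      cexp (π * I * τ * ∑ i, ((M *ᵥ (y + a)) i : ℂ) ^ 2) =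
    (I / τ) ^ (Fintype.card ι / 2 : ℂ) * cexp (-(π * I / τ) * ∑ i, ((M *ᵥ n) i : ℂ) ^ 2 +
      2 * π * I * ∑ i, ((M *ᵥ n) i : ℂ) * (M *ᵥ a) i) := by
  have hdet : M.det ≠ 0 := by
    intro h; simp [h] at hM
  have hτ0 : τ ≠ 0 := by rintro rfl; simp at hτ
  have hb : 0 < (-(π * I * τ)).re := by
    simp; positivity
  have hmpM : MeasurePreserving (M.toLin') volume volume := by
    refine ⟨(LinearMap.continuous_of_finiteDimensional _).measurable, ?_⟩
    rw [Real.map_matrix_volume_pi_eq_smul_volume_pi hdet, abs_inv, hM]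
    simp
  have hmp : MeasurePreserving (fun y : ι → ℝ => M *ᵥ (y + a)) volume volume :=
    hmpM.comp (measurePreserving_add_right volume a)
  let e : (ι → ℝ) ≃ₜ (ι → ℝ) := (Homeomorph.addRight a).trans
    (LinearEquiv.toContinuousLinearEquiv (M.toLinearEquiv' (by
      exact (M.isUnit_iff_isUnit_det.mpr (isUnit_iff_ne_zero.mpr hdet)).invertible))).toHomeomorph
  have hemb : MeasurableEmbedding (fun y : ι → ℝ => M *ᵥ (y + a)) :=
    e.measurableEmbedding
  constructor
  · have := GaussianFourier.integrable_cexp_neg_mul_sum_add hb (0 : ι → ℂ)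
    refine ((hmp.integrable_comp_emb hemb).mpr this).congr (.of_forall fun y => ?_)
    simp
  · have := GaussianFourier.integral_cexp_neg_mul_sum_add hb
      (fun i => -(2 * π * I * (M *ᵥ n) i))
    rw [← hmp.integral_comp hemb] at this
    have h2 : ∀ y : ι → ℝ, cexp (-(2 * π * I * ∑ i, ((M *ᵥ n) i : ℂ) * (M *ᵥ y) i)) *
      cexp (π * I * τ * ∑ i, ((M *ᵥ (y + a)) i : ℂ) ^ 2) =
      cexp (2 * π * I * ∑ i, ((M *ᵥ n) i : ℂ) * (M *ᵥ a) i) *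
      cexp (-(-(π * I * τ)) * ∑ i, ((M *ᵥ (y + a)) i : ℂ) ^ 2 +
        ∑ i, -(2 * π * I * (M *ᵥ n) i) * (M *ᵥ (y + a)) i) := by
      intro y
      rw [← Complex.exp_add, ← Complex.exp_add]
      congr 1
      simp only [mulVec_add, Pi.add_apply, ofReal_add, neg_mul, Finset.sum_neg_distrib, mul_assoc]
      simp only [← Finset.mul_sum, mul_add, Finset.sum_add_distrib]
      ring
    simp only [h2]
    rw [integral_const_mul, this, Complex.exp_add]
    have h3 : (π : ℂ) / -(π * I * τ) = I / τ := by
      have := Complex.I_sq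
      field_simp
      linear_combination -this
    have h4 : (∑ i, (-(2 * π * I * ((M *ᵥ n) i : ℂ))) ^ 2) / (4 * -(π * I * τ)) =
        -(π * I / τ) * ∑ i, ((M *ᵥ n) i : ℂ) ^ 2 := by
      rw [Finset.sum_div, Finset.mul_sum]
      refine Finset.sum_congr rfl fun i _ => ?_
      field_simp
      ring
    rw [h3, h4]
    ring

theorem exists_summable_exp_mulVec_le {M : Matrix ι ι ℝ} (hM : M.det ≠ 0) {t : ℝ} (ht : 0 < t)
    (a : ι → ℝ) (R : ℝ) : ∃ u : (ι → ℤ) → ℝ, Summable u ∧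
      ∀ (x : ι → ℤ) (y : ι → ℝ), ‖y‖ ≤ R →
        rexp (-(t * ∑ i, (M *ᵥ ((fun i => y i + x i) + a)) i ^ 2)) ≤ u x := by
  obtain ⟨c, hc, h⟩ := exists_mul_sum_sq_le hM
  have hs := (summable_exp_neg_mul_sum_sq (ι := ι) (ε := t * c / 2) (by positivity)).mul_left
    (rexp (t * c * ∑ i, (R + |a i|) ^ 2))
  refine ⟨_, hs, fun x y hy => ?_⟩
  rw [← Real.exp_add, Real.exp_le_exp]
  have h2 : (1 / 2 : ℝ) * ∑ i, (x i : ℝ) ^ 2 - ∑ i, (R + |a i|) ^ 2 ≤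
      ∑ i, ((fun i => y i + x i) + a) i ^ 2 := by
    rw [Finset.mul_sum, ← Finset.sum_sub_distrib]
    refine Finset.sum_le_sum fun i _ => ?_
    have hyi : |y i| ≤ R := (norm_le_pi_norm y i).trans hy
    have h3 : |y i + a i| ≤ R + |a i| := (abs_add_le _ _).trans (by linarith)
    have h4 := sq_le_sq.mpr (h3.trans (le_abs_self _))
    simp only [Pi.add_apply]
    nlinarith [sq_nonneg (x i + 2 * (y i + a i))]
  have h6 := mul_le_mul_of_nonneg_left h2 hc.le
  have h7 := mul_le_mul_of_nonneg_left (h6.trans (h _)) ht.le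
  linarith

/-- The inversion formula for the theta series of a unimodular lattice, in coordinates. -/
theorem tsum_cexp_mulVec_inversion {M : Matrix ι ι ℝ} {G : Matrix ι ι ℤ}
    (hG : G.map (Int.cast : ℤ → ℝ) = Mᵀ * M) (hdet : IsUnit G.det) {τ : ℂ} (hτ : 0 < τ.im)
    (a : ι → ℝ) :
    ∑' x : ι → ℤ, cexp (π * I * τ * ∑ i, ((M *ᵥ ((fun j => (x j : ℝ)) + a)) i : ℂ) ^ 2) =
      (I / τ) ^ (Fintype.card ι / 2 : ℂ) * ∑' x : ι → ℤ,
        cexp (-(π * I / τ) * ∑ i, ((M *ᵥ fun j => (x j : ℝ)) i : ℂ) ^ 2 +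
          2 * π * I * ∑ i, ((M *ᵥ fun j => (x j : ℝ)) i : ℂ) * (M *ᵥ a) i) := by
  have hM : |M.det| = 1 := by
    have h1 : ((G.det : ℤ) : ℝ) = M.det * M.det := by
      have := congrArg Matrix.det hG
      rw [det_mul, det_transpose] at this
      rw [← this]
      exact (Int.castRingHom ℝ).map_det G
    have h2 : |(G.det : ℝ)| = 1 := by
      rw [← Int.cast_abs, Int.isUnit_iff_abs_eq.mp hdet, Int.cast_one]
    rw [h1, abs_mul] at h2
    nlinarith [abs_nonneg M.det]
  have hM0 : M.det ≠ 0 := by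
    intro h; simp [h] at hM
  have hint := integral_gaussian_mulVec hM hτ a
  let e : (ι → ℤ) ≃ (ι → ℤ) :=
    { toFun := fun n => G *ᵥ n
      invFun := fun n => G⁻¹ *ᵥ n
      left_inv := fun n => by
        change G⁻¹ *ᵥ (G *ᵥ n) = n
        rw [mulVec_mulVec, nonsing_inv_mul _ hdet, one_mulVec]
      right_inv := fun n => by
        change G *ᵥ (G⁻¹ *ᵥ n) = n
        rw [mulVec_mulVec, mul_nonsing_inv _ hdet, one_mulVec] }
  have he : ∀ (n : ι → ℤ) (y : ι → ℝ), ∑ i, ((e n i : ℤ) : ℂ) * (y i : ℂ) =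
      ∑ i, ((M *ᵥ fun j => (n j : ℝ)) i : ℂ) * (M *ᵥ y) i := by
    intro n y
    have h1 : (fun i => ((e n i : ℤ) : ℝ)) = Mᵀ *ᵥ (M *ᵥ fun j => (n j : ℝ)) := by
      rw [mulVec_mulVec, ← hG]
      funext i
      simp [e, mulVec, dotProduct]
    have h2 : (fun i => ((e n i : ℤ) : ℝ)) ⬝ᵥ y = (M *ᵥ fun j => (n j : ℝ)) ⬝ᵥ (M *ᵥ y) := by
      rw [h1, dotProduct_mulVec, mulVec_transpose]
    simp only [dotProduct] at h2
    exact_mod_cast h2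
  have hcoef : ∀ n : ι → ℤ, ∫ y : ι → ℝ, cexp (-(2 * π * I * ∑ i, ((e n i : ℤ) : ℂ) * y i)) *
      cexp (π * I * τ * ∑ i, ((M *ᵥ (y + a)) i : ℂ) ^ 2) = _ := fun n => by
    simp only [he]
    exact (hint (fun j => (n j : ℝ))).2
  have hcont : Continuous fun y : ι → ℝ =>
      cexp (π * I * τ * ∑ i, ((M *ᵥ (y + a)) i : ℂ) ^ 2) := by
    have : Continuous fun y : ι → ℝ => M *ᵥ (y + a) :=
      Continuous.matrix_mulVec continuous_const (continuous_id.add continuous_const)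
    refine (continuous_const.mul (continuous_finsetSum _ fun i _ => ?_)).cexp
    exact (continuous_ofReal.comp ((continuous_apply i).comp this)).pow 2
  have hbd : ∀ R : ℝ, ∃ u : (ι → ℤ) → ℝ, Summable u ∧
      ∀ (x : ι → ℤ) (y : ι → ℝ), ‖y‖ ≤ R →
        ‖cexp (π * I * τ * ∑ i, ((M *ᵥ ((fun i => y i + x i) + a)) i : ℂ) ^ 2)‖ ≤ u x := by
    intro R
    simp only [norm_cexp_mul_sum_sq]
    exact exists_summable_exp_mulVec_le hM0 (by positivity) a R
  have hsum : Summable fun m : ι → ℤ =>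
      ∫ y : ι → ℝ, cexp (-(2 * π * I * ∑ i, (m i : ℂ) * y i)) *
        cexp (π * I * τ * ∑ i, ((M *ᵥ (y + a)) i : ℂ) ^ 2) := by
    rw [← e.summable_iff]
    have him : 0 < π * (τ.im / normSq τ) := by
      have : 0 < normSq τ := normSq_pos.mpr (by rintro rfl; simp at hτ)
      positivity
    refine Summable.congr (Summable.mul_left ((I / τ) ^ (Fintype.card ι / 2 : ℂ))
      (Summable.of_norm_bounded (summable_exp_neg_mul_sum_mulVec_sq hM0 him) fun n => ?_))
      fun n => (hcoef n).symm
    rw [Complex.norm_exp]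
    refine Real.exp_le_exp.mpr (le_of_eq ?_)
    have h1 : ∑ i, ((M *ᵥ fun j => (n j : ℝ)) i : ℂ) ^ 2 =
        ((∑ i, (M *ᵥ fun j => (n j : ℝ)) i ^ 2 : ℝ) : ℂ) := by push_cast; rfl
    have h2 : ∑ i, ((M *ᵥ fun j => (n j : ℝ)) i : ℂ) * (M *ᵥ a) i =
        ((∑ i, (M *ᵥ fun j => (n j : ℝ)) i * (M *ᵥ a) i : ℝ) : ℂ) := by push_cast; rfl
    rw [h1, h2, add_re, re_mul_ofReal, re_mul_ofReal]
    simp [div_eq_mul_inv, Complex.inv_im, Complex.inv_re]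
  rw [tsum_eq_tsum_integral hcont (hint 0).1 hbd hsum, ← e.tsum_eq, ← tsum_mul_left]
  exact tsum_congr hcoef

end GaussianPoisson

section Lattice

open Complex Module Matrix
open scoped Real

/-- `N` is a full unimodular lattice in the positive definite rational quadratic space `(V, B)`. -/
structure IsPosDefUnimodular {V : Type*} [AddCommGroup V] [Module ℚ V]
    (B : V →ₗ[ℚ] V →ₗ[ℚ] ℚ) (N : Submodule ℤ V) : Prop where
  fg : N.FG
  span_eq_top : Submodule.span ℚ (N : Set V) = ⊤
  symm : ∀ x y, B x y = B y x
  pos : ∀ x, x ≠ 0 → 0 < B x x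
  integral : ∀ x ∈ N, ∀ y ∈ N, ∃ n : ℤ, B x y = n
  mem_of_integral : ∀ v, (∀ y ∈ N, ∃ n : ℤ, B v y = n) → v ∈ N

namespace IsPosDefUnimodular

variable {V : Type*} [AddCommGroup V] [Module ℚ V] {B : V →ₗ[ℚ] V →ₗ[ℚ] ℚ} {N : Submodule ℤ V}

theorem nondegenerate (hN : IsPosDefUnimodular B N) : B.Nondegenerate :=
  ⟨fun x hx => by_contra fun h => (hN.pos x h).ne' (hx x),
    fun x hx => by_contra fun h => (hN.pos x h).ne' (hx x)⟩

theorem exists_basis [FiniteDimensional ℚ V] (hN : IsPosDefUnimodular B N) :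
    ∃ (b : Basis (Fin (finrank ℚ V)) ℤ N) (c : Basis (Fin (finrank ℚ V)) ℚ V),
      ∀ i, c i = b i := by
  have : IsAddTorsionFree V := .of_module_rat _
  have : Module.Finite ℤ N := Module.Finite.iff_fg.mpr hN.fg
  obtain ⟨n, b⟩ := Module.basisOfFiniteTypeTorsionFree' (R := ℤ) (M := N)
  have hli : LinearIndependent ℚ (fun i => (b i : V)) := by
    rw [← LinearIndependent.iff_fractionRing ℤ ℚ]
    exact b.linearIndependent.map' N.subtype (Submodule.ker_subtype N)
  have hsp : ⊤ ≤ Submodule.span ℚ (Set.range fun i => (b i : V)) := by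
    rw [← hN.span_eq_top]
    refine Submodule.span_le.mpr fun x hx => ?_
    have := congrArg (Subtype.val) (b.sum_repr ⟨x, hx⟩)
    simp only [AddSubmonoidClass.coe_finsetSum, SetLike.val_smul] at this
    rw [← this]
    refine Submodule.sum_mem _ fun i _ => ?_
    rw [← Int.cast_smul_eq_zsmul ℚ]
    exact Submodule.smul_mem _ _ (Submodule.subset_span ⟨i, rfl⟩)
  let c := Basis.mk hli hsp
  have hn : n = finrank ℚ V := by rw [finrank_eq_card_basis c, Fintype.card_fin]
  subst hn
  exact ⟨b, c, fun i => by simp [c]⟩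

theorem exists_orthogonal_basis [FiniteDimensional ℚ V] (hN : IsPosDefUnimodular B N) :
    ∃ e : Basis (Fin (finrank ℚ V)) ℚ V,
      ∀ v w, B v w = ∑ i, B v (e i) * B w (e i) / B (e i) (e i) := by
  obtain ⟨e, he⟩ := LinearMap.BilinForm.exists_orthogonal_basis (B := B) ⟨hN.symm⟩
  rw [LinearMap.isOrthoᵢ_def] at he
  have h0 : ∀ i, B (e i) (e i) ≠ 0 := fun i => (hN.pos _ (e.ne_zero i)).ne'
  have h1 : ∀ v i, B v (e i) = e.repr v i * B (e i) (e i) := fun v i => by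
    conv_lhs => rw [← e.sum_repr v]
    simp only [map_sum, map_smul, LinearMap.sum_apply, LinearMap.smul_apply, smul_eq_mul]
    rw [Finset.sum_eq_single i (fun j _ hj => by rw [he j i hj, mul_zero]) (by simp)]
  refine ⟨e, fun v w => ?_⟩
  conv_lhs => rw [← e.sum_repr w]
  simp only [map_sum, map_smul, smul_eq_mul]
  refine Finset.sum_congr rfl fun i _ => ?_
  rw [h1 w i]
  field_simp [h0 i]

/-- Real coordinates on `V` identifying `N` with `ℤⁿ` and `B` with the form of a real matrix. -/
theorem exists_coordinates [FiniteDimensional ℚ V] (hN : IsPosDefUnimodular B N) :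
    ∃ (M : Matrix (Fin (finrank ℚ V)) (Fin (finrank ℚ V)) ℝ)
      (G : Matrix (Fin (finrank ℚ V)) (Fin (finrank ℚ V)) ℤ)
      (e : (Fin (finrank ℚ V) → ℤ) ≃ N) (φ : V → Fin (finrank ℚ V) → ℝ),
      G.map (Int.cast : ℤ → ℝ) = Mᵀ * M ∧ IsUnit G.det ∧
      (∀ x, φ (e x) = fun j => (x j : ℝ)) ∧
      ∀ v w, ∑ i, (M *ᵥ φ v) i * (M *ᵥ φ w) i = (B v w : ℝ) := by
  obtain ⟨b, c, hbc⟩ := hN.exists_basis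
  obtain ⟨e, he⟩ := hN.exists_orthogonal_basis
  choose G hG using fun i j => hN.integral _ (b i).2 _ (b j).2
  have hpos : ∀ i, (0 : ℝ) < (B (e i) (e i) : ℝ) := fun i =>
    Rat.cast_pos.mpr (hN.pos _ (e.ne_zero i))
  let M : Matrix (Fin (finrank ℚ V)) (Fin (finrank ℚ V)) ℝ :=
    .of fun i j => (B (c j) (e i) : ℝ) / √(B (e i) (e i) : ℝ)
  let φ : V → Fin (finrank ℚ V) → ℝ := fun v j => (c.repr v j : ℝ)
  have hMφ : ∀ v i, (M *ᵥ φ v) i = (B v (e i) : ℝ) / √(B (e i) (e i) : ℝ) := fun v i => by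
    conv_rhs => rw [← c.sum_repr v]
    simp only [map_sum, map_smul, LinearMap.sum_apply, LinearMap.smul_apply, smul_eq_mul,
      Rat.cast_sum, Rat.cast_mul, Finset.sum_div, mulVec, dotProduct]
    refine Finset.sum_congr rfl fun j _ => ?_
    simp only [M, φ, Matrix.of_apply]
    ring
  have hB : ∀ v w, ∑ i, (M *ᵥ φ v) i * (M *ᵥ φ w) i = (B v w : ℝ) := fun v w => by
    rw [he v w, Rat.cast_sum]
    refine Finset.sum_congr rfl fun i _ => ?_
    rw [hMφ, hMφ, div_mul_div_comm, Real.mul_self_sqrt (hpos i).le]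
    push_cast
    rfl
  refine ⟨M, .of G, b.equivFun.symm.toEquiv, φ, ?_, ?_, ?_, hB⟩
  · ext j k
    have h1 := hB (c j) (c k)
    rw [hbc, hbc, hG] at h1
    simp only [Matrix.map_apply, Matrix.of_apply, Matrix.mul_apply, Matrix.transpose_apply]
    rw [Rat.cast_intCast] at h1
    rw [← h1, ← hbc, ← hbc]
    refine Finset.sum_congr rfl fun i _ => ?_
    rw [hMφ, hMφ]
    simp [M]
  · let d := LinearMap.BilinForm.dualBasis B hN.nondegenerate c
    have hd : ∀ i j, B (d i) (c j) = if j = i then 1 else 0 :=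
      LinearMap.BilinForm.apply_dualBasis_left hN.nondegenerate c
    have hdN : ∀ i, d i ∈ N := fun i => hN.mem_of_integral _ fun y hy => by
      have h2 := congrArg (Subtype.val) (b.sum_repr ⟨y, hy⟩)
      simp only [AddSubmonoidClass.coe_finsetSum, SetLike.val_smul] at h2
      refine ⟨b.repr ⟨y, hy⟩ i, ?_⟩
      have h3 := congrArg (B (d i)) h2
      rw [← h3]
      simp only [map_sum, map_zsmul, ← hbc, hd]
      simp
    let H : Matrix (Fin (finrank ℚ V)) (Fin (finrank ℚ V)) ℤ := .of fun i j => b.repr ⟨d i, hdN i⟩ j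
    refine Matrix.isUnit_det_of_left_inverse (B := H) ?_
    ext i j
    have h2 := congrArg (Subtype.val) (b.sum_repr ⟨d i, hdN i⟩)
    simp only [AddSubmonoidClass.coe_finsetSum, SetLike.val_smul] at h2
    have h3 := hd i j
    rw [← h2, map_sum, LinearMap.sum_apply] at h3
    simp only [map_zsmul, LinearMap.smul_apply, hbc, hG] at h3
    simp only [Matrix.mul_apply, H, Matrix.of_apply, Matrix.one_apply]
    have h4 : ((∑ k, b.repr ⟨d i, hdN i⟩ k * G k j : ℤ) : ℚ) =
        ((if j = i then 1 else 0 : ℤ) : ℚ) := by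
      push_cast
      rw [← h3]
      simp
    rw [Int.cast_inj.mp h4]
    simp only [eq_comm]
  · intro x
    funext j
    simp only [φ, LinearEquiv.coe_toEquiv, Basis.equivFun_symm_apply,
      AddSubmonoidClass.coe_finsetSum, SetLike.val_smul, ← hbc, map_sum, map_zsmul]
    simp [Finsupp.single_apply]

theorem det_ne_zero_of_map_eq {ι : Type*} [Fintype ι] [DecidableEq ι] {M : Matrix ι ι ℝ}
    {G : Matrix ι ι ℤ} (hG : G.map (Int.cast : ℤ → ℝ) = Mᵀ * M) (hdet : IsUnit G.det) :
    M.det ≠ 0 := fun h => by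
  have h1 := congrArg Matrix.det hG
  rw [Matrix.det_mul, h, mul_zero] at h1
  have h2 : (G.map (Int.cast : ℤ → ℝ)).det = (G.det : ℝ) :=
    ((Int.castRingHom ℝ).map_det G).symm
  rw [h2, Int.cast_eq_zero] at h1
  exact hdet.ne_zero h1

theorem summable_exp_neg [FiniteDimensional ℚ V] (hN : IsPosDefUnimodular B N) {ε : ℝ}
    (hε : 0 < ε) : Summable fun x : N => rexp (-ε * (B x x : ℝ)) := by
  obtain ⟨M, G, e, φ, hG, hdet, hφ, hB⟩ := hN.exists_coordinates
  refine e.summable_iff.mp ?_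
  refine (summable_exp_neg_mul_sum_mulVec_sq (det_ne_zero_of_map_eq hG hdet) hε).congr fun x => ?_
  simp only [Function.comp_apply, ← hB, hφ, pow_two]

theorem tsum_cexp_inversion [FiniteDimensional ℚ V] (hN : IsPosDefUnimodular B N)
    (hr : finrank ℚ V = 24) {τ : ℂ} (hτ : 0 < τ.im) (w : V) (u : ℝ) :
    ∑' x : N, cexp (π * I * τ * ((B x x : ℝ) + 2 * u * (B x w : ℝ) + u ^ 2 * (B w w : ℝ))) =
      (τ ^ 12)⁻¹ * ∑' x : N, cexp (-(π * I / τ) * (B x x : ℝ) + 2 * π * I * u * (B x w : ℝ)) := by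
  obtain ⟨M, G, e, φ, hG, hdet, hφ, hB⟩ := hN.exists_coordinates
  have h1 := tsum_cexp_mulVec_inversion hG hdet hτ (u • φ w)
  have hτ0 : τ ≠ 0 := fun h => by simp [h] at hτ
  have h2 : (I / τ) ^ ((Fintype.card (Fin (finrank ℚ V)) : ℂ) / 2) = (τ ^ 12)⁻¹ := by
    rw [Fintype.card_fin, hr, show ((24 : ℕ) : ℂ) / 2 = (12 : ℕ) by norm_num, cpow_natCast, div_pow,
      show I ^ 12 = (I ^ 4) ^ 3 by ring, I_pow_four]
    simp
  rw [h2] at h1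
  rw [← e.tsum_eq (fun x : N => cexp (π * I * τ * (_ + _ + _))),
    ← e.tsum_eq (fun x : N => cexp (_ + _))]
  have hC : ∀ v w, ∑ i, ((M *ᵥ φ v) i : ℂ) * ((M *ᵥ φ w) i : ℂ) = ((B v w : ℝ) : ℂ) := fun v w => by
    rw [← hB]; push_cast; rfl
  have hL : ∀ x : Fin (finrank ℚ V) → ℤ,
      ∑ i, ((M *ᵥ ((fun j => (x j : ℝ)) + u • φ w)) i : ℂ) ^ 2 =
        (B (e x) (e x) : ℝ) + 2 * u * (B (e x) w : ℝ) + u ^ 2 * (B w w : ℝ) := fun x => by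
    rw [← hC, ← hC, ← hC, ← hφ, Finset.mul_sum, Finset.mul_sum, ← Finset.sum_add_distrib,
      ← Finset.sum_add_distrib]
    refine Finset.sum_congr rfl fun i _ => ?_
    rw [Matrix.mulVec_add, Matrix.mulVec_smul]
    simp only [Pi.add_apply, Pi.smul_apply, smul_eq_mul]
    push_cast
    ring
  have hR1 : ∀ x : Fin (finrank ℚ V) → ℤ,
      ∑ i, ((M *ᵥ (fun j => (x j : ℝ))) i : ℂ) ^ 2 = (B (e x) (e x) : ℝ) := fun x => by
    rw [← hC, ← hφ]
    exact Finset.sum_congr rfl fun i _ => pow_two _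
  have hR2 : ∀ x : Fin (finrank ℚ V) → ℤ,
      ∑ i, ((M *ᵥ (fun j => (x j : ℝ))) i : ℂ) * ((M *ᵥ (u • φ w)) i : ℂ) =
        u * (B (e x) w : ℝ) := fun x => by
    rw [← hC, ← hφ, Finset.mul_sum, Matrix.mulVec_smul]
    refine Finset.sum_congr rfl fun i _ => ?_
    simp only [Pi.smul_apply, smul_eq_mul]
    push_cast
    ring
  simp only [hL, hR1, hR2] at h1
  rw [h1]
  simp only [mul_assoc]

theorem finite_norm_eq [FiniteDimensional ℚ V] (hN : IsPosDefUnimodular B N) (c : ℚ) :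
    {x : V | x ∈ N ∧ B x x = c}.Finite := by
  have h1 := (hN.summable_exp_neg one_pos).tendsto_cofinite_zero
  have h2 := h1.eventually_lt_const (Real.exp_pos (-1 * (c : ℝ)))
  rw [Filter.eventually_cofinite] at h2
  refine (h2.image Subtype.val).subset fun x hx => ⟨⟨x, hx.1⟩, ?_, rfl⟩
  simp [hx.2]

theorem sq_le (hN : IsPosDefUnimodular B N) (x y : V) : B x y ^ 2 ≤ B x x * B y y := by
  rcases eq_or_ne y 0 with rfl | hy
  · simp
  have hy' := hN.pos y hy
  have h1 : 0 ≤ B (B y y • x - B x y • y) (B y y • x - B x y • y) := by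
    rcases eq_or_ne (B y y • x - B x y • y) 0 with h | h
    · simp [h]
    · exact (hN.pos _ h).le
  simp only [map_sub, map_smul, LinearMap.sub_apply, LinearMap.smul_apply, smul_eq_mul,
    hN.symm y x] at h1
  nlinarith

theorem nonneg (hN : IsPosDefUnimodular B N) (x : V) : 0 ≤ B x x := by
  rcases eq_or_ne x 0 with rfl | h
  · simp
  · exact (hN.pos x h).le

theorem norm_eq_zero_iff (hN : IsPosDefUnimodular B N) {x : V} : B x x = 0 ↔ x = 0 :=
  ⟨fun h => by_contra fun h' => (hN.pos x h').ne' h, fun h => by simp [h]⟩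

end IsPosDefUnimodular

end Lattice

section SecondDifference

open Filter Topology Complex

theorem norm_cexp_add_cexp_neg_sub_two_le (z : ℂ) :
    ‖cexp z + cexp (-z) - 2‖ ≤ 2 * ‖z‖ ^ 2 * Real.exp ‖z‖ := by
  have h1 := Complex.norm_exp_sub_sum_le_norm_mul_exp z 2
  have h2 := Complex.norm_exp_sub_sum_le_norm_mul_exp (-z) 2
  simp only [Finset.sum_range_succ, Finset.sum_range_zero, norm_neg] at h1 h2
  have h3 := norm_add_le_of_le h1 h2
  refine (le_of_eq ?_).trans (h3.trans (le_of_eq (by ring)))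
  congr 1
  norm_num
  ring

theorem norm_cexp_add_cexp_neg_sub_two_sub_sq_le (z : ℂ) :
    ‖cexp z + cexp (-z) - 2 - z ^ 2‖ ≤ 2 * ‖z‖ ^ 3 * Real.exp ‖z‖ := by
  have h1 := Complex.norm_exp_sub_sum_le_norm_mul_exp z 3
  have h2 := Complex.norm_exp_sub_sum_le_norm_mul_exp (-z) 3
  simp only [Finset.sum_range_succ, Finset.sum_range_zero, norm_neg] at h1 h2
  have h3 := norm_add_le_of_le h1 h2
  refine (le_of_eq ?_).trans (h3.trans (le_of_eq (by ring)))
  congr 1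
  norm_num
  ring

theorem tendsto_cexp_add_cexp_neg_sub_two_div_sq (c : ℂ) :
    Tendsto (fun u : ℝ => (cexp (u * c) + cexp (-(u * c)) - 2) / (u : ℂ) ^ 2) (𝓝[≠] 0)
      (𝓝 (c ^ 2)) := by
  rw [tendsto_iff_norm_sub_tendsto_zero]
  have h1 : Tendsto (fun u : ℝ => 2 * |u| * ‖c‖ ^ 3 * Real.exp (|u| * ‖c‖)) (𝓝[≠] 0) (𝓝 0) := by
    have : Continuous fun u : ℝ => 2 * |u| * ‖c‖ ^ 3 * Real.exp (|u| * ‖c‖) := by fun_prop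
    have h := this.tendsto 0
    simp only [abs_zero, mul_zero, zero_mul] at h
    exact h.mono_left nhdsWithin_le_nhds
  refine squeeze_zero' (.of_forall fun _ => norm_nonneg _) ?_ h1
  filter_upwards [self_mem_nhdsWithin] with u hu
  have hu' : (u : ℂ) ≠ 0 := ofReal_ne_zero.mpr hu
  have hu'' : 0 < |u| := abs_pos.mpr hu
  have h2 := norm_cexp_add_cexp_neg_sub_two_sub_sq_le (u * c)
  have h3 : (cexp (u * c) + cexp (-(u * c)) - 2) / (u : ℂ) ^ 2 - c ^ 2 =
      (cexp (u * c) + cexp (-(u * c)) - 2 - (u * c) ^ 2) / (u : ℂ) ^ 2 := by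
    field_simp
  rw [h3, norm_div, norm_pow, norm_real, Real.norm_eq_abs, div_le_iff₀ (by positivity)]
  rw [norm_mul, norm_real, Real.norm_eq_abs] at h2
  exact h2.trans (le_of_eq (by ring))

theorem tendsto_tsum_second_difference {X : Type*} {a c : X → ℂ}
    (hs : Summable fun x => ‖a x‖ * Real.exp (2 * ‖c x‖)) :
    Tendsto (fun u : ℝ =>
        ∑' x, a x * ((cexp (u * c x) + cexp (-(u * c x)) - 2) / (u : ℂ) ^ 2)) (𝓝[≠] 0)
      (𝓝 (∑' x, a x * c x ^ 2)) := by
  have h : Summable fun x => ‖a x‖ * ‖c x‖ ^ 2 * Real.exp ‖c x‖ := by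
    refine (hs.mul_left 2).of_nonneg_of_le (fun _ => by positivity) fun x => ?_
    have h1 := Real.quadratic_le_exp_of_nonneg (norm_nonneg (c x))
    have h2 : ‖c x‖ ^ 2 ≤ 2 * Real.exp ‖c x‖ := by linarith [norm_nonneg (c x)]
    rw [two_mul ‖c x‖, Real.exp_add]
    calc _ ≤ ‖a x‖ * (2 * Real.exp ‖c x‖) * Real.exp ‖c x‖ := by gcongr
      _ = _ := by ring
  refine tendsto_tsum_of_dominated_convergence (h.mul_left 2)
    (fun x => (tendsto_cexp_add_cexp_neg_sub_two_div_sq (c x)).const_mul _) ?_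
  have h1 : ∀ᶠ u : ℝ in 𝓝[≠] 0, |u| ≤ 1 := by
    filter_upwards [nhdsWithin_le_nhds (Metric.closedBall_mem_nhds (0 : ℝ) one_pos)] with u hu
    simpa using hu
  filter_upwards [self_mem_nhdsWithin, h1] with u hu hu1 x
  have hu'' : 0 < |u| := abs_pos.mpr hu
  have h2 := norm_cexp_add_cexp_neg_sub_two_le (u * c x)
  rw [norm_mul, norm_real, Real.norm_eq_abs] at h2
  have h3 : ‖(cexp (u * c x) + cexp (-(u * c x)) - 2) / (u : ℂ) ^ 2‖ ≤
      2 * ‖c x‖ ^ 2 * Real.exp ‖c x‖ := by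
    rw [norm_div, norm_pow, norm_real, Real.norm_eq_abs, div_le_iff₀ (by positivity)]
    refine h2.trans ?_
    have h4 : Real.exp (|u| * ‖c x‖) ≤ Real.exp ‖c x‖ :=
      Real.exp_le_exp.mpr (mul_le_of_le_one_left (norm_nonneg _) hu1)
    calc 2 * (|u| * ‖c x‖) ^ 2 * Real.exp (|u| * ‖c x‖)
        ≤ 2 * (|u| * ‖c x‖) ^ 2 * Real.exp ‖c x‖ := by gcongr
      _ = _ := by ring
  rw [norm_mul]
  calc _ ≤ ‖a x‖ * (2 * ‖c x‖ ^ 2 * Real.exp ‖c x‖) := by gcongr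
    _ = _ := by ring

theorem tsum_mul_sq_of_forall_cexp {X : Type*} {a c a' c' : X → ℂ}
    (hs : ∀ K : ℝ, Summable fun x => ‖a x‖ * Real.exp (K * ‖c x‖))
    (hs' : ∀ K : ℝ, Summable fun x => ‖a' x‖ * Real.exp (K * ‖c' x‖)) {κ t : ℂ}
    (h : ∀ u : ℝ, cexp ((u : ℂ) ^ 2 * κ) * ∑' x, a x * cexp (u * c x) =
      t * ∑' x, a' x * cexp (u * c' x)) :
    ∑' x, a x * c x ^ 2 + 2 * κ * ∑' x, a x = t * ∑' x, a' x * c' x ^ 2 := by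
  have hsum : ∀ {a c : X → ℂ}, (∀ K : ℝ, Summable fun x => ‖a x‖ * Real.exp (K * ‖c x‖)) →
      ∀ u : ℝ, Summable fun x => a x * cexp (u * c x) := fun {a c} hs u => by
    refine Summable.of_norm_bounded (hs |u|) fun x => ?_
    rw [norm_mul]
    gcongr
    refine (Complex.norm_exp_le_exp_norm _).trans_eq ?_
    rw [norm_mul, norm_real, Real.norm_eq_abs]
  have hsplit : ∀ {a c : X → ℂ}, (∀ K : ℝ, Summable fun x => ‖a x‖ * Real.exp (K * ‖c x‖)) →
      ∀ u : ℝ, ∑' x, a x * ((cexp (u * c x) + cexp (-(u * c x)) - 2) / (u : ℂ) ^ 2) =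
        (∑' x, a x * cexp (u * c x) + ∑' x, a x * cexp ((-u : ℝ) * c x) - 2 * ∑' x, a x) /
          (u : ℂ) ^ 2 := fun {a c} hs u => by
    have h0 := hsum hs 0
    simp only [ofReal_zero, zero_mul, Complex.exp_zero, mul_one] at h0
    rw [← (hsum hs u).tsum_add (hsum hs (-u)), ← tsum_mul_left,
      ← ((hsum hs u).add (hsum hs (-u))).tsum_sub (h0.mul_left 2), ← tsum_div_const]
    refine tsum_congr fun x => ?_
    rw [ofReal_neg, neg_mul]
    ring
  have h1 := tendsto_tsum_second_difference (hs 2)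
  have h2 := (tendsto_tsum_second_difference (hs' 2)).const_mul t
  have hsq : Tendsto (fun u : ℝ => (u : ℂ) ^ 2) (𝓝[≠] 0) (𝓝[≠] 0) := by
    refine tendsto_nhdsWithin_iff.mpr ⟨?_, ?_⟩
    · have : Continuous fun u : ℝ => (u : ℂ) ^ 2 := by fun_prop
      have h := this.tendsto 0
      simp only [ofReal_zero, ne_eq, OfNat.ofNat_ne_zero, not_false_eq_true, zero_pow] at h
      exact h.mono_left nhdsWithin_le_nhds
    · filter_upwards [self_mem_nhdsWithin] with u hu
      exact pow_ne_zero 2 (ofReal_ne_zero.mpr hu)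
  have h3 : Tendsto (fun u : ℝ => cexp ((u : ℂ) ^ 2 * κ)) (𝓝[≠] 0) (𝓝 1) := by
    have : Continuous fun u : ℝ => cexp ((u : ℂ) ^ 2 * κ) := by fun_prop
    have h := this.tendsto 0
    simp only [ofReal_zero, ne_eq, OfNat.ofNat_ne_zero, not_false_eq_true, zero_pow, zero_mul,
      Complex.exp_zero] at h
    exact h.mono_left nhdsWithin_le_nhds
  have h4 : Tendsto (fun u : ℝ => (cexp ((u : ℂ) ^ 2 * κ) - 1) / (u : ℂ) ^ 2) (𝓝[≠] 0) (𝓝 κ) := by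
    have hd : HasDerivAt (fun z : ℂ => cexp (z * κ)) κ 0 := by
      simpa using ((hasDerivAt_id (0 : ℂ)).mul_const κ).cexp
    refine (hd.tendsto_slope.comp hsq).congr fun u => ?_
    simp [slope_def_field]
  have h5 := (h3.mul h1).add (h4.mul_const (2 * ∑' x, a x))
  rw [one_mul] at h5
  have h6 := tendsto_nhds_unique (h5.congr' ?_) h2
  · linear_combination h6
  filter_upwards [self_mem_nhdsWithin] with u hu
  rw [hsplit hs, hsplit hs']
  have e0 := h 0
  have e1 := h u
  have e2 := h (-u)
  simp only [ofReal_zero, zero_mul, Complex.exp_zero, mul_one, ne_eq, OfNat.ofNat_ne_zero,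
    not_false_eq_true, zero_pow, one_mul] at e0
  rw [ofReal_neg, neg_sq, ← ofReal_neg] at e2
  have hu' : (u : ℂ) ≠ 0 := ofReal_ne_zero.mpr hu
  field_simp
  linear_combination e1 + e2 - 2 * e0

end SecondDifference

namespace IsPosDefUnimodular

open Complex Module Filter Topology
open scoped Real

variable {V : Type*} [AddCommGroup V] [Module ℚ V] {B : V →ₗ[ℚ] V →ₗ[ℚ] ℚ} {N : Submodule ℤ V}

theorem summable_exp_neg_add_abs [FiniteDimensional ℚ V] (hN : IsPosDefUnimodular B N) {ε : ℝ}
    (hε : 0 < ε) (w : V) (K : ℝ) :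
    Summable fun x : N => rexp (-ε * (B x x : ℝ) + K * |(B x w : ℝ)|) := by
  have hw : (0 : ℝ) ≤ (B w w : ℝ) := Rat.cast_nonneg.mpr (hN.nonneg w)
  obtain ⟨δ, hδ, hδ'⟩ : ∃ δ : ℝ, 0 < δ ∧ δ * (K ^ 2 * (B w w : ℝ)) ≤ ε / 2 := by
    refine ⟨ε / 2 / (K ^ 2 * (B w w : ℝ) + 1), by positivity, ?_⟩
    rw [div_mul_eq_mul_div, div_le_iff₀ (by positivity)]
    nlinarith
  refine ((hN.summable_exp_neg (half_pos hε)).mul_left (rexp δ⁻¹)).of_nonneg_of_le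
    (fun _ => (Real.exp_pos _).le) fun x => ?_
  rw [← Real.exp_add, Real.exp_le_exp]
  have h1 : (B x w : ℝ) ^ 2 ≤ (B x x : ℝ) * (B w w : ℝ) := by exact_mod_cast hN.sq_le x w
  have h2 : (0 : ℝ) ≤ (B x x : ℝ) := Rat.cast_nonneg.mpr (hN.nonneg x)
  have h3 : K * |(B x w : ℝ)| ≤ δ * (K * |(B x w : ℝ)|) ^ 2 + δ⁻¹ := by
    have h4 : 0 ≤ δ⁻¹ * ((δ * (K * |(B x w : ℝ)|)) ^ 2 - δ * (K * |(B x w : ℝ)|) + 1) := by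
      refine mul_nonneg (inv_pos.mpr hδ).le ?_
      nlinarith [sq_nonneg (δ * (K * |(B x w : ℝ)|) - 1), sq_nonneg (δ * (K * |(B x w : ℝ)|) + 1)]
    have h5 : δ⁻¹ * ((δ * (K * |(B x w : ℝ)|)) ^ 2 - δ * (K * |(B x w : ℝ)|) + 1) =
      δ * (K * |(B x w : ℝ)|) ^ 2 - K * |(B x w : ℝ)| + δ⁻¹ := by field_simp
    linarith
  have h6 : δ * (K * |(B x w : ℝ)|) ^ 2 ≤ ε / 2 * (B x x : ℝ) := by
    rw [mul_pow, sq_abs]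
    calc δ * (K ^ 2 * (B x w : ℝ) ^ 2) ≤ δ * (K ^ 2 * ((B x x : ℝ) * (B w w : ℝ))) := by gcongr
      _ = δ * (K ^ 2 * (B w w : ℝ)) * (B x x : ℝ) := by ring
      _ ≤ _ := by gcongr
  linarith

theorem summable_sq_mul_exp_neg [FiniteDimensional ℚ V] (hN : IsPosDefUnimodular B N)
    {ε : ℝ} (hε : 0 < ε) (w : V) :
    Summable fun x : N => (B x w : ℝ) ^ 2 * rexp (-ε * (B x x : ℝ)) := by
  refine ((hN.summable_exp_neg_add_abs hε w 1).mul_left 2).of_nonneg_of_le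
    (fun _ => by positivity) fun x => ?_
  have h1 := Real.quadratic_le_exp_of_nonneg (abs_nonneg (B x w : ℝ))
  have h2 : (B x w : ℝ) ^ 2 ≤ 2 * rexp |(B x w : ℝ)| := by
    rw [sq_abs] at h1
    linarith [abs_nonneg (B x w : ℝ)]
  rw [one_mul, Real.exp_add]
  calc _ ≤ 2 * rexp |(B x w : ℝ)| * rexp (-ε * (B x x : ℝ)) := by gcongr
    _ = _ := by ring

/-- The transformation of the theta series of `N` with the degree two coefficient `B(x, w)²`. -/
theorem tsum_sq_mul_cexp_inversion [FiniteDimensional ℚ V] (hN : IsPosDefUnimodular B N)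
    (hr : finrank ℚ V = 24) {τ : ℂ} (hτ : 0 < τ.im) (w : V) :
    ∑' x : N, ((B x w : ℝ) : ℂ) ^ 2 * cexp (-(π * I / τ) * (B x x : ℝ)) =
      τ ^ 14 * ∑' x : N, ((B x w : ℝ) : ℂ) ^ 2 * cexp (π * I * τ * (B x x : ℝ)) -
        I / (2 * π) * τ ^ 13 * (B w w : ℝ) * ∑' x : N, cexp (π * I * τ * (B x x : ℝ)) := by
  have hτ0 : τ ≠ 0 := fun h => by simp [h] at hτ
  have hn1 : ∀ x : N, ‖cexp (π * I * τ * (B x x : ℝ))‖ = rexp (-(π * τ.im) * (B x x : ℝ)) :=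
    fun x => by
      rw [Complex.norm_exp]
      congr 1
      simp [Complex.mul_re, Complex.mul_im]
  have him : 0 < (-1 / τ).im := by
    rw [neg_div, Complex.neg_im, Complex.div_im]
    have := Complex.normSq_pos.mpr hτ0
    simp
    positivity
  have hn2 : ∀ x : N, ‖cexp (-(π * I / τ) * (B x x : ℝ))‖ =
      rexp (-(π * (-1 / τ).im) * (B x x : ℝ)) := fun x => by
    rw [Complex.norm_exp, show -(π * I / τ) * ((B x x : ℝ) : ℂ) = π * I * (-1 / τ) * (B x x : ℝ) by
      ring]
    congr 1
    simp [Complex.mul_re, Complex.mul_im]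
  have hs1 : ∀ K : ℝ, Summable fun x : N => ‖cexp (π * I * τ * (B x x : ℝ))‖ *
      rexp (K * ‖2 * π * I * τ * ((B x w : ℝ) : ℂ)‖) := fun K => by
    refine (hN.summable_exp_neg_add_abs (mul_pos Real.pi_pos hτ) w
      (K * ‖2 * π * I * τ‖)).congr fun x => ?_
    rw [hn1, Real.exp_add, norm_mul _ ((B x w : ℝ) : ℂ), norm_real, Real.norm_eq_abs, mul_assoc K]
  have hs2 : ∀ K : ℝ, Summable fun x : N => ‖cexp (-(π * I / τ) * (B x x : ℝ))‖ *
      rexp (K * ‖2 * π * I * ((B x w : ℝ) : ℂ)‖) := fun K => by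
    refine (hN.summable_exp_neg_add_abs (mul_pos Real.pi_pos him) w
      (K * ‖2 * π * I‖)).congr fun x => ?_
    rw [hn2, Real.exp_add, norm_mul _ ((B x w : ℝ) : ℂ), norm_real, Real.norm_eq_abs, mul_assoc K]
  have key := tsum_mul_sq_of_forall_cexp hs1 hs2 (κ := π * I * τ * (B w w : ℝ))
    (t := (τ ^ 12)⁻¹) fun u => by
      have h := hN.tsum_cexp_inversion hr hτ w u
      rw [← tsum_mul_left]
      simp only [← Complex.exp_add]
      refine Eq.trans ?_ (h.trans ?_)
      · refine tsum_congr fun x => ?_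
        congr 1
        ring
      · congr 1
        refine tsum_congr fun x => ?_
        congr 1
        ring
  have h1 : ∑' x : N, cexp (π * I * τ * (B x x : ℝ)) * (2 * π * I * τ * ((B x w : ℝ) : ℂ)) ^ 2 =
      -(4 * π ^ 2 * τ ^ 2) *
        ∑' x : N, ((B x w : ℝ) : ℂ) ^ 2 * cexp (π * I * τ * (B x x : ℝ)) := by
    rw [← tsum_mul_left]
    refine tsum_congr fun x => ?_
    linear_combination (4 * π ^ 2 * τ ^ 2 * ((B x w : ℝ) : ℂ) ^ 2 *
      cexp (π * I * τ * (B x x : ℝ))) * I_sq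
  have h2 : ∑' x : N, cexp (-(π * I / τ) * (B x x : ℝ)) * (2 * π * I * ((B x w : ℝ) : ℂ)) ^ 2 =
      -(4 * π ^ 2) * ∑' x : N, ((B x w : ℝ) : ℂ) ^ 2 * cexp (-(π * I / τ) * (B x x : ℝ)) := by
    rw [← tsum_mul_left]
    refine tsum_congr fun x => ?_
    linear_combination (4 * π ^ 2 * ((B x w : ℝ) : ℂ) ^ 2 *
      cexp (-(π * I / τ) * (B x x : ℝ))) * I_sq
  rw [h1, h2] at key
  have hπ : (π : ℂ) ≠ 0 := ofReal_ne_zero.mpr Real.pi_ne_zero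
  generalize ∑' x : N, ((B x w : ℝ) : ℂ) ^ 2 * cexp (-(π * I / τ) * (B x x : ℝ)) = P' at *
  generalize ∑' x : N, ((B x w : ℝ) : ℂ) ^ 2 * cexp (π * I * τ * (B x x : ℝ)) = P at *
  generalize ∑' x : N, cexp (π * I * τ * (B x x : ℝ)) = T at *
  field_simp at key ⊢
  linear_combination key / 2

end IsPosDefUnimodular

section Slash

open UpperHalfPlane hiding I
open Complex ModularForm
open scoped MatrixGroups Real

theorem coe_modular_S_smul (τ : ℍ) : ((ModularGroup.S • τ : ℍ) : ℂ) = -1 / τ := by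
  rw [modular_S_smul]
  simp [div_eq_mul_inv]

theorem slash_S_eq_iff {k : ℤ} {F G : ℍ → ℂ} :
    F ∣[k] ModularGroup.S = G ↔
      ∀ τ : ℍ, F (ModularGroup.S • τ) = (τ : ℂ) ^ k * G τ := by
  rw [funext_iff]
  refine forall_congr' fun τ => ?_
  rw [SL_slash_apply]
  have : denom (ModularGroup.S : SL(2, ℤ)) τ = τ := by
    rw [ModularGroup.denom_apply]
    simp [ModularGroup.S]
  rw [this, zpow_neg, ← div_eq_mul_inv, div_eq_iff (zpow_ne_zero _ (ne_zero τ)), mul_comm]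

theorem slash_T_apply (k : ℤ) (F : ℍ → ℂ) (τ : ℍ) :
    (F ∣[k] ModularGroup.T) τ = F ((1 : ℝ) +ᵥ τ) := by
  rw [SL_slash_apply, modular_T_smul, ModularGroup.denom_apply]
  simp [ModularGroup.T]

theorem cexp_pi_I_mul_vadd (t : ℝ) (τ : ℍ) :
    cexp (π * I * t * ((1 : ℝ) +ᵥ τ : ℍ)) = cexp (π * I * t) * cexp (π * I * t * τ) := by
  rw [coe_vadd, ← Complex.exp_add]
  congr 1
  push_cast
  ring

end Slash

namespace IsPosDefUnimodular

open UpperHalfPlane hiding I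
open Complex Module Filter Topology ModularForm
open scoped Real Manifold MatrixGroups

variable {V : Type*} [AddCommGroup V] [Module ℚ V] {B : V →ₗ[ℚ] V →ₗ[ℚ] ℚ} {N : Submodule ℤ V}

theorem tsum_ite_norm_eq_two [FiniteDimensional ℚ V] (hN : IsPosDefUnimodular B N) (g : V → ℂ) :
    ∑' x : N, (if (B x x : ℝ) = 2 then g x else 0) =
      ∑ r ∈ (hN.finite_norm_eq 2).toFinset, g r := by
  have h1 := tsum_subtype (N : Set V) (fun x => if (B x x : ℝ) = 2 then g x else 0)
  refine h1.trans ?_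
  rw [tsum_eq_sum (s := (hN.finite_norm_eq 2).toFinset)]
  · refine Finset.sum_congr rfl fun x hx => ?_
    have hx' := (hN.finite_norm_eq 2).mem_toFinset.mp hx
    rw [Set.indicator_of_mem hx'.1, if_pos]
    rw [hx'.2]; norm_num
  · intro x hx
    rw [Set.Finite.mem_toFinset] at hx
    by_cases hxN : x ∈ (N : Set V)
    · rw [Set.indicator_of_mem hxN, if_neg]
      exact fun h => hx ⟨hxN, by exact_mod_cast h⟩
    · exact Set.indicator_of_notMem hxN _

theorem norm_eq_of_even (hN : IsPosDefUnimodular B N)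
    (heven : ∀ x ∈ N, ∃ n : ℤ, B x x = 2 * n) (x : N) :
    (B x x : ℝ) = 0 ∨ (B x x : ℝ) = 2 ∨ 3 ≤ (B x x : ℝ) := by
  obtain ⟨n, hn⟩ := heven x x.2
  have h0 := hN.nonneg (x : V)
  rw [hn] at h0 ⊢
  have h1 : 0 ≤ n := by
    have : (0 : ℚ) ≤ n := by linarith
    exact_mod_cast this
  rcases (by omega : n = 0 ∨ n = 1 ∨ 2 ≤ n) with rfl | rfl | h
  · simp
  · right; left; norm_num
  · right; right
    have : (2 : ℝ) ≤ n := by exact_mod_cast h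
    push_cast
    linarith

/-- Proportionality of the quadratic form of the roots to the norm. -/
theorem sum_roots_sq_mul_eq [FiniteDimensional ℚ V] (hN : IsPosDefUnimodular B N)
    (hr : finrank ℚ V = 24) (heven : ∀ x ∈ N, ∃ n : ℤ, B x x = 2 * n) (w w' : V) :
    (∑ r ∈ (hN.finite_norm_eq 2).toFinset, B r w ^ 2) * B w' w' =
      (∑ r ∈ (hN.finite_norm_eq 2).toFinset, B r w' ^ 2) * B w w := by
  let W : V → ℂ := fun x =>
    ((B x w : ℝ) : ℂ) ^ 2 * (B w' w' : ℝ) - ((B x w' : ℝ) : ℂ) ^ 2 * (B w w : ℝ)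
  have hQ := hN.norm_eq_of_even heven
  have hQ0 : ∀ x : N, 0 ≤ (B x x : ℝ) := fun x => Rat.cast_nonneg.mpr (hN.nonneg x)
  have hs1 : ∀ w : V, ∀ ε > 0, Summable fun x : N =>
      ‖((B x w : ℝ) : ℂ) ^ 2‖ * rexp (-π * ε * (B x x : ℝ)) := fun w ε hε => by
    refine (hN.summable_sq_mul_exp_neg (mul_pos Real.pi_pos hε) w).congr fun x => ?_
    rw [norm_pow, norm_real, Real.norm_eq_abs, sq_abs, neg_mul, neg_mul, neg_mul]
  have hs : ∀ ε > 0, Summable fun x : N => ‖W x‖ * rexp (-π * ε * (B x x : ℝ)) := fun ε hε => by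
    refine (((hs1 w ε hε).mul_right ‖((B w' w' : ℝ) : ℂ)‖).add
      ((hs1 w' ε hε).mul_right ‖((B w w : ℝ) : ℂ)‖)).of_nonneg_of_le (fun _ => by positivity)
      fun x => ?_
    calc _ ≤ (‖((B x w : ℝ) : ℂ) ^ 2‖ * ‖((B w' w' : ℝ) : ℂ)‖ +
        ‖((B x w' : ℝ) : ℂ) ^ 2‖ * ‖((B w w : ℝ) : ℂ)‖) * rexp (-π * ε * (B x x : ℝ)) := by
          gcongr
          refine (norm_sub_le _ _).trans_eq ?_
          rw [norm_mul, norm_mul]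
      _ = _ := by ring
  let F : ℍ → ℂ := fun τ => ∑' x : N, W x * cexp (π * I * (B x x : ℝ) * τ)
  have hF : ∀ τ : ℍ, F τ = (∑' x : N, ((B x w : ℝ) : ℂ) ^ 2 * cexp (π * I * τ * (B x x : ℝ))) *
      (B w' w' : ℝ) - (∑' x : N, ((B x w' : ℝ) : ℂ) ^ 2 * cexp (π * I * τ * (B x x : ℝ))) *
      (B w w : ℝ) := fun τ => by
    have h0 : ∀ x : N, cexp (π * I * τ * (B x x : ℝ)) = cexp (π * I * (B x x : ℝ) * τ) :=
      fun x => by rw [mul_right_comm]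
    have h1 := fun w => summable_mul_cexp hQ0 (hs1 w) τ.im_pos
    simp only [h0]
    rw [← tsum_mul_right, ← tsum_mul_right,
      ← Summable.tsum_sub ((h1 w).mul_right _) ((h1 w').mul_right _)]
    refine tsum_congr fun x => ?_
    simp only [W]
    ring
  have hS : F ∣[(14 : ℤ)] ModularGroup.S = F := by
    rw [slash_S_eq_iff]
    intro τ
    rw [hF, hF, coe_modular_S_smul]
    have h1 := hN.tsum_sq_mul_cexp_inversion hr τ.im_pos w
    have h2 := hN.tsum_sq_mul_cexp_inversion hr τ.im_pos w'
    rw [show (π : ℂ) * I * (-1 / (τ : ℂ)) = -(π * I / τ) by ring]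
    rw [h1, h2, show ((14 : ℤ)) = ((14 : ℕ) : ℤ) by rfl, zpow_natCast]
    ring
  have hT : F ∣[(14 : ℤ)] ModularGroup.T = F := by
    funext τ
    rw [slash_T_apply]
    refine tsum_congr fun x => ?_
    rw [cexp_pi_I_mul_vadd]
    obtain ⟨n, hn⟩ := heven x x.2
    have h1 : cexp (π * I * (B x x : ℝ)) = 1 := by
      rw [hn, ← Complex.exp_int_mul_two_pi_mul_I n]
      congr 1
      push_cast
      ring
    rw [h1, one_mul]
  have key := levelOne_weight_fourteen_coeff_one (mdifferentiable_tsum_mul_cexp hQ0 hs) hS hT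
    (tendsto_tsum_sub_div_qParam hQ hs)
  have h0 : ∑' x : N, (if (B x x : ℝ) = 0 then W x else 0) = 0 := by
    refine (tsum_congr fun x : N => ?_).trans tsum_zero
    split_ifs with h
    · have hx : (x : V) = 0 := hN.norm_eq_zero_iff.mp (by exact_mod_cast h)
      simp [W, hx]
    · rfl
  rw [h0, mul_zero, hN.tsum_ite_norm_eq_two W, Finset.sum_sub_distrib, ← Finset.sum_mul,
    ← Finset.sum_mul, sub_eq_zero] at key
  exact_mod_cast key

/-- Venkov's theorem: the roots of an even unimodular lattice of rank 24 form a 2-design. -/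
theorem twelve_mul_sum_roots_sq [FiniteDimensional ℚ V] (hN : IsPosDefUnimodular B N)
    (hr : finrank ℚ V = 24) (heven : ∀ x ∈ N, ∃ n : ℤ, B x x = 2 * n) (w : V) :
    12 * ∑ r ∈ (hN.finite_norm_eq 2).toFinset, B r w ^ 2 =
      (hN.finite_norm_eq 2).toFinset.card * B w w := by
  obtain ⟨e, he⟩ := hN.exists_orthogonal_basis
  set R := (hN.finite_norm_eq 2).toFinset
  have h1 : ∀ i, ∑ r ∈ R, B r w ^ 2 = (∑ r ∈ R, B r (e i) ^ 2) / B (e i) (e i) * B w w :=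
    fun i => by
      rw [div_mul_eq_mul_div, eq_div_iff (hN.pos _ (e.ne_zero i)).ne']
      exact hN.sum_roots_sq_mul_eq hr heven w (e i)
  have h2 : 24 * ∑ r ∈ R, B r w ^ 2 =
      ∑ i, (∑ r ∈ R, B r (e i) ^ 2) / B (e i) (e i) * B w w := by
    rw [← Finset.sum_congr rfl fun i _ => h1 i]
    simp [hr]
  have h3 : ∑ i, (∑ r ∈ R, B r (e i) ^ 2) / B (e i) (e i) = 2 * R.card := by
    simp only [Finset.sum_div]
    rw [Finset.sum_comm]
    have : ∀ r ∈ R, ∑ i, B r (e i) ^ 2 / B (e i) (e i) = 2 := fun r hr => by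
      rw [← ((hN.finite_norm_eq 2).mem_toFinset.mp hr).2, he r r]
      simp only [pow_two]
    rw [Finset.sum_congr rfl this]
    simp [mul_comm]
  rw [← Finset.sum_mul, h3] at h2
  linarith

end IsPosDefUnimodular

section EisensteinTwo

open UpperHalfPlane hiding I
open Complex Filter Topology ModularForm EisensteinSeries
open scoped MatrixGroups Real Manifold

theorem tendsto_E2_sub_one_div_qParam :
    Tendsto (fun τ : ℍ => (E2 τ - 1) / Function.Periodic.qParam 1 τ) atImInfty (𝓝 (-24)) := by
  let w : ℕ → ℂ := fun m => if m = 0 then 1 else -24 * (ArithmeticFunction.sigma 1 m : ℂ)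
  have hQ : ∀ m : ℕ, (2 * m : ℝ) = 0 ∨ (2 * m : ℝ) = 2 ∨ 3 ≤ (2 * m : ℝ) := fun m => by
    rcases (by omega : m = 0 ∨ m = 1 ∨ 2 ≤ m) with rfl | rfl | h
    · simp
    · simp
    · right; right
      have : (2 : ℝ) ≤ m := by exact_mod_cast h
      linarith
  have hE (τ : ℍ) : HasSum (fun m : ℕ => w m * cexp (π * I * (2 * m : ℝ) * τ)) (E2 τ) := by
    refine (hasSum_qExpansion_E2 (z := τ)).congr_fun fun m => ?_
    rw [smul_eq_mul, ← Complex.exp_nat_mul]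
    congr 2
    push_cast
    ring
  have hs : ∀ ε > 0, Summable fun m : ℕ => ‖w m‖ * rexp (-π * ε * (2 * m : ℝ)) := fun ε hε => by
    have h1 := (hE ⟨ε * I, by simpa using hε⟩).summable.norm
    refine h1.congr fun m => ?_
    rw [norm_mul, norm_cexp_pi_I_mul_mul]
    simp
  have h := tendsto_tsum_sub_div_qParam hQ hs
  have h0 : ∑' m : ℕ, (if (2 * m : ℝ) = 0 then w m else 0) = 1 := by
    rw [tsum_eq_single 0 (fun m hm => by simp [hm])]
    simp [w]
  have h2 : ∑' m : ℕ, (if (2 * m : ℝ) = 2 then w m else 0) = -24 := by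
    rw [tsum_eq_single 1 (fun m hm => by simp [hm])]
    simp [w]
  rw [h0, h2] at h
  refine h.congr fun τ => ?_
  rw [(hE τ).tsum_eq]

theorem exists_E2_modular_S_smul :
    ∃ k : ℂ, ∀ τ : ℍ, E2 (ModularGroup.S • τ) = (τ : ℂ) ^ 2 * E2 τ - k * τ := by
  refine ⟨1 / (2 * riemannZeta 2) * (2 * π * I), fun τ => ?_⟩
  have h := slash_S_eq_iff.mp (E2_slash_action ModularGroup.S) τ
  have h0 : (τ : ℂ) ≠ 0 := ne_zero τ
  rw [h, Pi.sub_apply, Pi.smul_apply, D2_S, smul_eq_mul, show (2 : ℤ) = ((2 : ℕ) : ℤ) by rfl,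
    zpow_natCast]
  field_simp

theorem E2_one_vadd (τ : ℍ) : E2 ((1 : ℝ) +ᵥ τ) = E2 τ := by
  have h := congrFun (E2_slash_action ModularGroup.T) τ
  rw [slash_T_apply] at h
  simpa [D2_T] using h

/-- The positive number `2`, acting on the upper half plane by scaling. -/
def posTwo : {x : ℝ // 0 < x} := ⟨2, two_pos⟩

/-- The positive number `1 / 2`, acting on the upper half plane by scaling. -/
noncomputable def posHalf : {x : ℝ // 0 < x} := ⟨1 / 2, one_half_pos⟩

/-- The weight two Eisenstein series `2 E₂(2τ) - E₂(τ)` of level `Γ₀(2)`. -/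
noncomputable def eisensteinTwo (τ : ℍ) : ℂ := 2 * E2 (posTwo • τ) - E2 τ

/-- The transform of `eisensteinTwo` under `S`. -/
noncomputable def eisensteinTwoDual (τ : ℍ) : ℂ := 1 / 2 * E2 (posHalf • τ) - E2 τ

theorem mdifferentiable_pos_smul {F : ℍ → ℂ} (hF : MDiff F) (p : {x : ℝ // 0 < x}) :
    MDiff (fun τ : ℍ => F (p • τ)) := by
  rw [UpperHalfPlane.mdifferentiable_iff] at hF ⊢
  have hp : ∀ z ∈ {z : ℂ | 0 < z.im}, 0 < ((p : ℝ) * z).im := fun z hz => by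
    simpa using mul_pos p.2 hz
  have h1 := hF.comp (f := fun z : ℂ => (p : ℝ) * z) (s := {z | 0 < z.im}) (by fun_prop) hp
  refine h1.congr fun z hz => ?_
  simp only [Function.comp_apply]
  rw [ofComplex_apply_of_im_pos hz, ofComplex_apply_of_im_pos (hp z hz)]
  congr 1

theorem mdifferentiable_eisensteinTwo : MDiff eisensteinTwo :=
  (mdifferentiable_const.mul (mdifferentiable_pos_smul E2_mdifferentiable posTwo)).sub
    E2_mdifferentiable

theorem mdifferentiable_eisensteinTwoDual : MDiff eisensteinTwoDual :=
  (mdifferentiable_const.mul (mdifferentiable_pos_smul E2_mdifferentiable posHalf)).sub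
    E2_mdifferentiable

theorem eisensteinTwo_modular_S_smul (τ : ℍ) :
    eisensteinTwo (ModularGroup.S • τ) = (τ : ℂ) ^ 2 * eisensteinTwoDual τ := by
  obtain ⟨k, hk⟩ := exists_E2_modular_S_smul
  have h : posTwo • ModularGroup.S • τ = ModularGroup.S • posHalf • τ := by
    ext
    rw [coe_pos_real_smul, coe_modular_S_smul, coe_modular_S_smul, coe_pos_real_smul]
    simp [posTwo, posHalf]
    ring
  rw [eisensteinTwo, eisensteinTwoDual, h, hk, hk, coe_pos_real_smul]
  simp [posHalf]
  ring

theorem eisensteinTwo_one_vadd (τ : ℍ) : eisensteinTwo ((1 : ℝ) +ᵥ τ) = eisensteinTwo τ := by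
  have h : posTwo • ((1 : ℝ) +ᵥ τ) = (1 : ℝ) +ᵥ ((1 : ℝ) +ᵥ posTwo • τ) := by
    ext
    simp [posTwo]
    ring
  rw [eisensteinTwo, eisensteinTwo, h, E2_one_vadd, E2_one_vadd, E2_one_vadd]

theorem eisensteinTwoDual_two_vadd (τ : ℍ) :
    eisensteinTwoDual ((1 : ℝ) +ᵥ ((1 : ℝ) +ᵥ τ)) = eisensteinTwoDual τ := by
  have h : posHalf • ((1 : ℝ) +ᵥ ((1 : ℝ) +ᵥ τ)) = (1 : ℝ) +ᵥ posHalf • τ := by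
    ext
    simp [posHalf]
    ring
  rw [eisensteinTwoDual, eisensteinTwoDual, h, E2_one_vadd, E2_one_vadd, E2_one_vadd]

theorem tendsto_pos_smul_atImInfty (p : {x : ℝ // 0 < x}) :
    Tendsto (fun τ : ℍ => p • τ) atImInfty atImInfty := by
  refine tendsto_comap_iff.mpr ?_
  have : Tendsto (fun τ : ℍ => (p : ℝ) * τ.im) atImInfty atTop :=
    tendsto_comap.const_mul_atTop p.2
  exact this.congr fun τ => (pos_real_im p τ).symm

theorem tendsto_vadd_atImInfty (t : ℝ) :
    Tendsto (fun τ : ℍ => t +ᵥ τ) atImInfty atImInfty := by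
  refine tendsto_comap_iff.mpr ?_
  have : Tendsto (fun τ : ℍ => τ.im) atImInfty atTop := tendsto_comap
  exact this.congr fun τ => (vadd_im t τ).symm

theorem tendsto_E2_atImInfty : Tendsto E2 atImInfty (𝓝 1) :=
  tendsto_atImInfty_of_tendsto_sub_div_qParam tendsto_E2_sub_one_div_qParam

theorem tendsto_eisensteinTwoDual : Tendsto eisensteinTwoDual atImInfty (𝓝 (-1 / 2)) := by
  have h := ((tendsto_E2_atImInfty.comp (tendsto_pos_smul_atImInfty posHalf)).const_mul
    (1 / 2 : ℂ)).sub tendsto_E2_atImInfty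
  rw [show (1 / 2 * 1 - 1 : ℂ) = -1 / 2 by norm_num] at h
  exact h

theorem tendsto_eisensteinTwo_sub_one_div_qParam :
    Tendsto (fun τ : ℍ => (eisensteinTwo τ - 1) / Function.Periodic.qParam 1 τ) atImInfty
      (𝓝 24) := by
  have h1 := tendsto_E2_sub_one_div_qParam.comp (tendsto_pos_smul_atImInfty posTwo)
  have h2 := ((h1.mul (qParam_tendsto_atImInfty (h := 1) one_pos)).const_mul 2).sub
    tendsto_E2_sub_one_div_qParam
  rw [show (2 * (-24 * 0) - -24 : ℂ) = 24 by norm_num] at h2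
  refine h2.congr fun τ => ?_
  have hq : Function.Periodic.qParam 1 (posTwo • τ : ℍ) = Function.Periodic.qParam 1 τ ^ 2 := by
    rw [Function.Periodic.qParam, Function.Periodic.qParam, ← Complex.exp_nat_mul,
      coe_pos_real_smul]
    congr 1
    simp [posTwo]
    ring
  have hq0 : Function.Periodic.qParam 1 τ ≠ 0 := Function.Periodic.qParam_ne_zero _
  simp only [Function.comp_apply, eisensteinTwo]
  rw [hq]
  field_simp
  ring

end EisensteinTwo

section Trace

open UpperHalfPlane hiding I
open ModularForm Complex Filter Topology
open scoped MatrixGroups Real Manifold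

theorem modular_S_smul_S_smul (τ : ℍ) : ModularGroup.S • ModularGroup.S • τ = τ := by
  ext
  rw [coe_modular_S_smul, coe_modular_S_smul]
  have := ne_zero τ
  field_simp

theorem S_mul_T_mul_S : ModularGroup.S * ModularGroup.T * ModularGroup.S =
    ModularGroup.T⁻¹ * ModularGroup.S * ModularGroup.T⁻¹ := by
  decide

/-- The trace from `Γ₀(2)` of a `T`-invariant function whose `S`-transform has period `2`. -/
theorem trace_slash_invariant {φ ψ : ℍ → ℂ} (hT : φ ∣[(14 : ℤ)] ModularGroup.T = φ)
    (hS : φ ∣[(14 : ℤ)] ModularGroup.S = ψ)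
    (hTT : (ψ ∣[(14 : ℤ)] ModularGroup.T) ∣[(14 : ℤ)] ModularGroup.T = ψ) :
    (φ + ψ + ψ ∣[(14 : ℤ)] ModularGroup.T) ∣[(14 : ℤ)] ModularGroup.S =
        φ + ψ + ψ ∣[(14 : ℤ)] ModularGroup.T ∧
      (φ + ψ + ψ ∣[(14 : ℤ)] ModularGroup.T) ∣[(14 : ℤ)] ModularGroup.T =
        φ + ψ + ψ ∣[(14 : ℤ)] ModularGroup.T := by
  have hS' : ψ ∣[(14 : ℤ)] ModularGroup.S = φ := by
    rw [slash_S_eq_iff] at hS ⊢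
    intro τ
    have h := hS (ModularGroup.S • τ)
    rw [modular_S_smul_S_smul, coe_modular_S_smul] at h
    have h0 : (τ : ℂ) ≠ 0 := ne_zero τ
    rw [h, ← mul_assoc, ← mul_zpow, mul_div_cancel₀ _ h0]
    rw [show (14 : ℤ) = ((14 : ℕ) : ℤ) by rfl, zpow_natCast]
    norm_num
  have hTi : φ ∣[(14 : ℤ)] ModularGroup.T⁻¹ = φ := by
    conv_lhs => rw [← hT]
    rw [← SlashAction.slash_mul, mul_inv_cancel, SlashAction.slash_one]
  have hTi' : ψ ∣[(14 : ℤ)] ModularGroup.T⁻¹ = ψ ∣[(14 : ℤ)] ModularGroup.T := by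
    conv_lhs => rw [← hTT]
    rw [← SlashAction.slash_mul, mul_inv_cancel, SlashAction.slash_one]
  have hTS : (ψ ∣[(14 : ℤ)] ModularGroup.T) ∣[(14 : ℤ)] ModularGroup.S =
      ψ ∣[(14 : ℤ)] ModularGroup.T := by
    conv_lhs => rw [← hS]
    rw [← SlashAction.slash_mul, ← SlashAction.slash_mul, ← mul_assoc,
      S_mul_T_mul_S, SlashAction.slash_mul,
      SlashAction.slash_mul, hTi, hS, hTi']
  rw [SlashAction.add_slash, SlashAction.add_slash, SlashAction.add_slash, SlashAction.add_slash,
    hTS, hT, hTT, hS, hS']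
  exact ⟨by rw [add_comm ψ φ], by rw [add_right_comm]⟩

/-- The first coefficient of a weight 14 form of level `Γ₀(2)` and those at its other cusp. -/
theorem coeff_one_of_trace {φ ψ : ℍ → ℂ} {c₀ a b : ℂ} (hφ : MDiff φ) (hψ : MDiff ψ)
    (hT : φ ∣[(14 : ℤ)] ModularGroup.T = φ) (hS : φ ∣[(14 : ℤ)] ModularGroup.S = ψ)
    (hTT : (ψ ∣[(14 : ℤ)] ModularGroup.T) ∣[(14 : ℤ)] ModularGroup.T = ψ)
    (ha : Tendsto (fun τ : ℍ => (φ τ - c₀) / Function.Periodic.qParam 1 τ) atImInfty (𝓝 a))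
    (hb : Tendsto (fun τ : ℍ => ψ τ / Function.Periodic.qParam 1 τ) atImInfty (𝓝 b)) :
    a + 2 * b = -24 * c₀ := by
  obtain ⟨h1, h2⟩ := trace_slash_invariant hT hS hTT
  refine levelOne_weight_fourteen_coeff_one ((hφ.add hψ).add (hψ.slash _ ModularGroup.T)) h1 h2 ?_
  have hb' := hb.comp (tendsto_vadd_atImInfty 1)
  rw [show a + 2 * b = a + b + b by ring]
  refine ((ha.add hb).add hb').congr fun τ => ?_
  have hq : Function.Periodic.qParam 1 ((1 : ℝ) +ᵥ τ : ℍ) = Function.Periodic.qParam 1 τ := by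
    simp only [Function.Periodic.qParam, coe_vadd, ofReal_one, div_one, mul_add, mul_one,
      Complex.exp_add, Complex.exp_two_pi_mul_I, one_mul]
  have h3 : (ψ ∣[(14 : ℤ)] ModularGroup.T) τ = ψ ((1 : ℝ) +ᵥ τ) := slash_T_apply ..
  change _ = (φ τ + ψ τ + (ψ ∣[(14 : ℤ)] ModularGroup.T) τ - c₀) / _
  rw [h3]
  simp only [Function.comp_apply, hq]
  ring

end Trace

namespace IsPosDefUnimodular

open UpperHalfPlane hiding I
open Complex Module Filter Topology ModularForm
open scoped Real Manifold MatrixGroups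

variable {V : Type*} [AddCommGroup V] [Module ℚ V] {B : V →ₗ[ℚ] V →ₗ[ℚ] ℚ} {N : Submodule ℤ V}

theorem summable_exp_neg_add [FiniteDimensional ℚ V] (hN : IsPosDefUnimodular B N) {ε : ℝ}
    (hε : 0 < ε) (v : V) : Summable fun x : N => rexp (-ε * (B (x + v) (x + v) : ℝ)) := by
  refine (hN.summable_exp_neg_add_abs hε v (2 * ε)).of_nonneg_of_le
    (fun _ => (Real.exp_pos _).le) fun x => ?_
  rw [Real.exp_le_exp]
  have h1 : (0 : ℝ) ≤ (B v v : ℝ) := Rat.cast_nonneg.mpr (hN.nonneg v)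
  have h2 : (B (x + v) (x + v) : ℝ) = (B x x : ℝ) + 2 * (B x v : ℝ) + (B v v : ℝ) := by
    simp only [map_add, LinearMap.add_apply, hN.symm v x]
    push_cast
    ring
  rw [h2]
  have h3 := neg_abs_le (B x v : ℝ)
  nlinarith

/-- The numbers of roots of an even unimodular lattice of rank 24, weighted by the character of
order two defined by `v`, and of vectors of norm two in the coset of `v`. -/
theorem sum_roots_cexp_eq [FiniteDimensional ℚ V] (hN : IsPosDefUnimodular B N)
    (hr : finrank ℚ V = 24) (heven : ∀ x ∈ N, ∃ n : ℤ, B x x = 2 * n) {v : V}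
    (hv : ∀ x ∈ N, ∃ n : ℤ, B (x + v) (x + v) = n ∧ 2 ≤ n) :
    ∑ r ∈ (hN.finite_norm_eq 2).toFinset, cexp (2 * π * I * (B r v : ℝ)) =
      (∑' x : N, if (B (x + v) (x + v) : ℝ) = 2 then (1 : ℂ) else 0) - 48 := by
  let W : V → ℂ := fun x => cexp (2 * π * I * (B x v : ℝ))
  have hWn : ∀ x, ‖W x‖ = 1 := fun x => by
    rw [show W x = cexp ((2 * π * (B x v : ℝ) : ℝ) * I) by simp only [W]; congr 1; push_cast; ring]
    exact Complex.norm_exp_ofReal_mul_I _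
  have hQ := hN.norm_eq_of_even heven
  have hQ0 : ∀ x : N, 0 ≤ (B x x : ℝ) := fun x => Rat.cast_nonneg.mpr (hN.nonneg x)
  have hQ' : ∀ x : N, (B (x + v) (x + v) : ℝ) = 0 ∨ (B (x + v) (x + v) : ℝ) = 2 ∨
      3 ≤ (B (x + v) (x + v) : ℝ) := fun x => by
    obtain ⟨n, hn, hn2⟩ := hv x x.2
    rw [hn]
    rcases (by omega : n = 2 ∨ 3 ≤ n) with rfl | h
    · right; left; norm_num
    · right; right; exact_mod_cast h
  have hQ0' : ∀ x : N, 0 ≤ (B (x + v) (x + v) : ℝ) := fun x => Rat.cast_nonneg.mpr (hN.nonneg _)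
  have hs : ∀ ε > 0, Summable fun x : N => ‖W x‖ * rexp (-π * ε * (B x x : ℝ)) := fun ε hε => by
    refine (hN.summable_exp_neg (mul_pos Real.pi_pos hε)).congr fun x => ?_
    rw [hWn, one_mul, neg_mul π]
  have hs' : ∀ ε > 0, Summable fun x : N => ‖(1 : ℂ)‖ * rexp (-π * ε * (B (x + v) (x + v) : ℝ)) :=
    fun ε hε => by
      refine (hN.summable_exp_neg_add (mul_pos Real.pi_pos hε) v).congr fun x => ?_
      rw [norm_one, one_mul, neg_mul π]
  let g₁ : ℍ → ℂ := fun τ => ∑' x : N, W x * cexp (π * I * (B x x : ℝ) * τ)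
  let g₂ : ℍ → ℂ := fun τ => ∑' x : N, 1 * cexp (π * I * (B (x + v) (x + v) : ℝ) * τ)
  have hg₁ : MDiff g₁ := mdifferentiable_tsum_mul_cexp hQ0 hs
  have hg₂ : MDiff g₂ := mdifferentiable_tsum_mul_cexp hQ0' hs'
  have hgS : ∀ τ : ℍ, g₁ (ModularGroup.S • τ) = (τ : ℂ) ^ 12 * g₂ τ := fun τ => by
    have h := hN.tsum_cexp_inversion hr τ.im_pos v 1
    have h0 : (τ : ℂ) ≠ 0 := ne_zero τ
    rw [eq_inv_mul_iff_mul_eq₀ (pow_ne_zero _ h0)] at h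
    refine Eq.trans ?_ (h.symm.trans ?_)
    · refine tsum_congr fun x => ?_
      simp only [W]
      rw [← Complex.exp_add, coe_modular_S_smul]
      congr 1
      push_cast
      ring
    · congr 1
      refine tsum_congr fun x => ?_
      rw [one_mul]
      congr 1
      simp only [map_add, LinearMap.add_apply, hN.symm v x]
      push_cast
      ring
  have hgT : ∀ τ : ℍ, g₁ ((1 : ℝ) +ᵥ τ) = g₁ τ := fun τ => by
    refine tsum_congr fun x => ?_
    rw [cexp_pi_I_mul_vadd]
    obtain ⟨n, hn⟩ := heven x x.2
    have h1 : cexp (π * I * (B x x : ℝ)) = 1 := by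
      rw [hn, ← Complex.exp_int_mul_two_pi_mul_I n]
      congr 1
      push_cast
      ring
    rw [h1, one_mul]
  have hgT' : ∀ τ : ℍ, g₂ ((1 : ℝ) +ᵥ ((1 : ℝ) +ᵥ τ)) = g₂ τ := fun τ => by
    refine tsum_congr fun x => ?_
    rw [cexp_pi_I_mul_vadd, cexp_pi_I_mul_vadd, ← mul_assoc (cexp _), ← Complex.exp_add]
    obtain ⟨n, hn, -⟩ := hv x x.2
    have h1 : cexp (π * I * (B (x + v) (x + v) : ℝ) + π * I * (B (x + v) (x + v) : ℝ)) = 1 := by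
      rw [hn, ← Complex.exp_int_mul_two_pi_mul_I n]
      congr 1
      push_cast
      ring
    rw [h1, one_mul]
  have hc0 : ∑' x : N, (if (B x x : ℝ) = 0 then W x else 0) = 1 := by
    rw [tsum_eq_single 0 fun x hx => if_neg fun h => hx ?_]
    · simp [W]
    · exact Subtype.ext (hN.norm_eq_zero_iff.mp (by exact_mod_cast h))
  have hc0' : ∑' x : N, (if (B (x + v) (x + v) : ℝ) = 0 then (1 : ℂ) else 0) = 0 := by
    refine (tsum_congr fun x : N => if_neg fun h => ?_).trans tsum_zero
    obtain ⟨n, hn, hn2⟩ := hv x x.2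
    rw [hn] at h
    have : n = 0 := by exact_mod_cast h
    omega
  have ht₁ := tendsto_tsum_sub_div_qParam hQ hs
  have ht₂ := tendsto_tsum_sub_div_qParam hQ' hs'
  rw [hc0, hN.tsum_ite_norm_eq_two W] at ht₁
  rw [hc0'] at ht₂
  simp only [sub_zero] at ht₂
  generalize ∑' x : N, (if (B (x + v) (x + v) : ℝ) = 2 then (1 : ℂ) else 0) = b at *
  have key := coeff_one_of_trace (φ := fun τ => g₁ τ * eisensteinTwo τ)
    (ψ := fun τ => g₂ τ * eisensteinTwoDual τ) (c₀ := 1)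
    (a := ∑ r ∈ (hN.finite_norm_eq 2).toFinset, W r + 24) (b := b * (-1 / 2))
    (hg₁.mul mdifferentiable_eisensteinTwo) (hg₂.mul mdifferentiable_eisensteinTwoDual)
    ?_ ?_ ?_ ?_ ?_
  · linear_combination key
  · funext τ
    rw [slash_T_apply, hgT, eisensteinTwo_one_vadd]
  · rw [slash_S_eq_iff]
    intro τ
    rw [hgS, eisensteinTwo_modular_S_smul, show (14 : ℤ) = ((14 : ℕ) : ℤ) by rfl, zpow_natCast]
    ring
  · funext τ
    rw [slash_T_apply, slash_T_apply, hgT', eisensteinTwoDual_two_vadd]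
  · have h1 := (ht₁.mul (tendsto_atImInfty_of_tendsto_sub_div_qParam
      tendsto_eisensteinTwo_sub_one_div_qParam)).add tendsto_eisensteinTwo_sub_one_div_qParam
    rw [mul_one] at h1
    refine h1.congr fun τ => ?_
    simp only [g₁]
    ring
  · refine (ht₂.mul tendsto_eisensteinTwoDual).congr fun τ => ?_
    simp only [g₂]
    ring

end IsPosDefUnimodular

section RootSystem

variable {V : Type*} [AddCommGroup V] [Module ℚ V] {B : V →ₗ[ℚ] V →ₗ[ℚ] ℚ} {R : Finset V}
  {f : V →ₗ[ℚ] ℚ}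

theorem sum_eq_two_mul_sum_filter_pos (hneg : ∀ r ∈ R, -r ∈ R) (hf : ∀ r ∈ R, f r ≠ 0)
    {g : V → ℚ} (hg : ∀ r, g (-r) = g r) :
    ∑ r ∈ R, g r = 2 * ∑ r ∈ R with 0 < f r, g r := by
  rw [← Finset.sum_filter_add_sum_filter_not R (fun r => 0 < f r) g, two_mul]
  congr 1
  refine Finset.sum_nbij' (fun r => -r) (fun r => -r) ?_ ?_ (fun _ _ => neg_neg _)
    (fun _ _ => neg_neg _) fun r _ => (hg r).symm
  · intro r hr
    simp only [Finset.mem_filter, map_neg, neg_pos] at hr ⊢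
    exact ⟨hneg r hr.1, lt_of_le_of_ne (not_lt.mp hr.2) (hf r hr.1)⟩
  · intro r hr
    simp only [Finset.mem_filter, map_neg] at hr ⊢
    exact ⟨hneg r hr.1, by linarith⟩

theorem root_apply_root_cases (hsymm : ∀ x y, B x y = B y x) (hpos : ∀ x, x ≠ 0 → 0 < B x x)
    (h2 : ∀ r ∈ R, B r r = 2) (hint : ∀ r ∈ R, ∀ s ∈ R, ∃ n : ℤ, B r s = n)
    {r s : V} (hr : r ∈ R) (hs : s ∈ R) :
    r = s ∨ r = -s ∨ B r s = 1 ∨ B r s = 0 ∨ B r s = -1 := by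
  by_cases h : r = s
  · exact Or.inl h
  by_cases h' : r = -s
  · exact Or.inr (Or.inl h')
  obtain ⟨n, hn⟩ := hint r hr s hs
  have h3 := hpos (r - s) (sub_ne_zero.mpr h)
  have h4 := hpos (r + s) (fun h0 => h' (eq_neg_of_add_eq_zero_left h0))
  simp only [map_add, map_sub, LinearMap.add_apply, LinearMap.sub_apply, h2 r hr, h2 s hs,
    hsymm s r, hn] at h3 h4
  have h5 : n < 2 := by
    have : (n : ℚ) < 2 := by linarith
    exact_mod_cast this
  have h6 : -2 < n := by
    have : (-2 : ℚ) < n := by linarith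
    exact_mod_cast this
  rw [hn]
  rcases (by omega : n = 1 ∨ n = 0 ∨ n = -1) with rfl | rfl | rfl <;> simp

theorem card_pos_pairs_eq [DecidableEq V] (hsymm : ∀ x y, B x y = B y x)
    (h2 : ∀ r ∈ R, B r r = 2) (hneg : ∀ r ∈ R, -r ∈ R)
    (hsub : ∀ r ∈ R, ∀ s ∈ R, B r s = 1 → r - s ∈ R) (hf : ∀ r ∈ R, f r ≠ 0)
    {P : Finset V} (hP : P = R.filter fun r => 0 < f r) :
    ((P ×ˢ P).filter fun p => B p.1 p.2 = 1).card =
      2 * ((P ×ˢ P).filter fun p => B p.1 p.2 = -1).card := by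
  have hmem : ∀ r, r ∈ P ↔ r ∈ R ∧ 0 < f r := fun r => by rw [hP, Finset.mem_filter]
  have key : ((P ×ˢ P).filter fun p => B p.1 p.2 = 1 ∧ f p.2 < f p.1).card =
      ((P ×ˢ P).filter fun p => B p.1 p.2 = -1).card := by
    refine Finset.card_nbij' (fun p => (p.1 - p.2, p.2)) (fun p => (p.1 + p.2, p.2)) ?_ ?_
      (fun _ _ => by simp) (fun _ _ => by simp)
    · rintro ⟨r, s⟩ hp
      simp only [Finset.coe_filter, Finset.mem_product, Set.mem_ofPred_eq, hmem] at hp ⊢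
      obtain ⟨⟨⟨hr, -⟩, hs, hs'⟩, h1, hlt⟩ := hp
      refine ⟨⟨⟨hsub r hr s hs h1, ?_⟩, hs, hs'⟩, ?_⟩
      · rw [map_sub]; linarith
      · rw [map_sub, LinearMap.sub_apply, h1, h2 s hs]; norm_num
    · rintro ⟨r, s⟩ hp
      simp only [Finset.coe_filter, Finset.mem_product, Set.mem_ofPred_eq, hmem] at hp ⊢
      obtain ⟨⟨⟨hr, hr'⟩, hs, hs'⟩, h1⟩ := hp
      refine ⟨⟨⟨?_, ?_⟩, hs, hs'⟩, ?_, ?_⟩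
      · have := hsub r hr (-s) (hneg s hs) (by rw [map_neg, h1, neg_neg])
        rwa [sub_neg_eq_add] at this
      · rw [map_add]; linarith
      · rw [map_add, LinearMap.add_apply, h1, h2 s hs]; norm_num
      · rw [map_add]; linarith
  have swap : ((P ×ˢ P).filter fun p => B p.1 p.2 = 1 ∧ ¬ f p.2 < f p.1).card =
      ((P ×ˢ P).filter fun p => B p.1 p.2 = 1 ∧ f p.2 < f p.1).card := by
    refine Finset.card_nbij' Prod.swap Prod.swap ?_ ?_ (fun _ _ => Prod.swap_swap _)
      (fun _ _ => Prod.swap_swap _)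
    · rintro ⟨r, s⟩ hp
      simp only [Finset.coe_filter, Finset.mem_product, Set.mem_ofPred_eq, hmem, Prod.swap] at hp ⊢
      obtain ⟨⟨⟨hr, hr'⟩, hs, hs'⟩, h1, hlt⟩ := hp
      refine ⟨⟨⟨hs, hs'⟩, hr, hr'⟩, by rw [hsymm, h1], lt_of_le_of_ne (not_lt.mp hlt) ?_⟩
      have := hf _ (hsub r hr s hs h1)
      rwa [map_sub, sub_ne_zero] at this
    · rintro ⟨r, s⟩ hp
      simp only [Finset.coe_filter, Finset.mem_product, Set.mem_ofPred_eq, hmem, Prod.swap] at hp ⊢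
      obtain ⟨⟨⟨hr, hr'⟩, hs, hs'⟩, h1, hlt⟩ := hp
      exact ⟨⟨⟨hs, hs'⟩, hr, hr'⟩, by rw [hsymm, h1], not_lt.mpr hlt.le⟩
  rw [← Finset.card_filter_add_card_filter_not (s := (P ×ˢ P).filter fun p => B p.1 p.2 = 1)
    (fun p => f p.2 < f p.1), Finset.filter_filter, Finset.filter_filter, swap, key, two_mul]

/-- The norm of the Weyl vector of a simply laced root system. -/
theorem weyl_norm_eq (hsymm : ∀ x y, B x y = B y x) (hpos : ∀ x, x ≠ 0 → 0 < B x x)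
    (h2 : ∀ r ∈ R, B r r = 2) (hint : ∀ r ∈ R, ∀ s ∈ R, ∃ n : ℤ, B r s = n)
    (hneg : ∀ r ∈ R, -r ∈ R) (hsub : ∀ r ∈ R, ∀ s ∈ R, B r s = 1 → r - s ∈ R)
    (hf : ∀ r ∈ R, f r ≠ 0) {ρ : V} (hρ : ρ = (2⁻¹ : ℚ) • ∑ r ∈ R with 0 < f r, r) :
    48 * B ρ ρ = ∑ r ∈ R, ∑ s ∈ R, B r s ^ 2 + 4 * R.card := by
  classical
  obtain ⟨P, hP⟩ : ∃ P : Finset V, P = R.filter fun r => 0 < f r := ⟨_, rfl⟩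
  have hmem : ∀ r, r ∈ P ↔ r ∈ R ∧ 0 < f r := fun r => by rw [hP, Finset.mem_filter]
  have hX : ∑ r ∈ R, ∑ s ∈ R, B r s ^ 2 = 4 * ∑ p ∈ P ×ˢ P, B p.1 p.2 ^ 2 := by
    rw [sum_eq_two_mul_sum_filter_pos hneg hf (fun r => by simp), Finset.sum_product, ← hP,
      Finset.mul_sum, Finset.mul_sum]
    refine Finset.sum_congr rfl fun r _ => ?_
    rw [sum_eq_two_mul_sum_filter_pos hneg hf (fun s => by simp), ← hP]
    ring
  have hcard : (R.card : ℚ) = 2 * P.card := by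
    have h := sum_eq_two_mul_sum_filter_pos (g := fun _ => 1) hneg hf fun _ => rfl
    rw [← hP] at h
    simpa using h
  have hB : 4 * B ρ ρ = ∑ p ∈ P ×ˢ P, B p.1 p.2 := by
    rw [hρ, ← hP, Finset.sum_product, Finset.sum_comm]
    simp only [map_smul, LinearMap.smul_apply, smul_eq_mul]
    rw [map_sum]
    simp only [map_sum, LinearMap.sum_apply]
    ring
  have hdiag : ∑ p ∈ P ×ˢ P, (if p.1 = p.2 then (1 : ℚ) else 0) = P.card := by
    rw [Finset.sum_product]
    simp
  have hpair := card_pos_pairs_eq hsymm h2 hneg hsub hf hP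
  have hval : ∑ p ∈ P ×ˢ P, (3 * B p.1 p.2 - B p.1 p.2 ^ 2
      - 2 * (if p.1 = p.2 then (1 : ℚ) else 0)) =
      ∑ p ∈ P ×ˢ P, (2 * (if B p.1 p.2 = 1 then (1 : ℚ) else 0)
        - 4 * (if B p.1 p.2 = -1 then (1 : ℚ) else 0)) := by
    refine Finset.sum_congr rfl fun p hp => ?_
    obtain ⟨hr, hs⟩ := Finset.mem_product.mp hp
    obtain ⟨hr, hr'⟩ := (hmem _).mp hr
    obtain ⟨hs, hs'⟩ := (hmem _).mp hs
    by_cases h : p.1 = p.2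
    · rw [← h, h2 _ hr]
      norm_num
    · rcases root_apply_root_cases hsymm hpos h2 hint hr hs with h0 | h0 | h0 | h0 | h0
      · exact absurd h0 h
      · rw [h0, map_neg] at hr'
        linarith
      all_goals
        rw [h0, if_neg h]
        norm_num
  simp only [Finset.sum_sub_distrib, ← Finset.mul_sum, hdiag] at hval
  rw [Finset.sum_boole, Finset.sum_boole, hpair, ← hB] at hval
  rw [hX, hcard]
  push_cast at hval
  linarith

end RootSystem

/-- `N` is an even unimodular lattice containing the even vectors of the unimodular lattice `A`. -/
structure IsEvenNeighbor {V : Type*} [AddCommGroup V] [Module ℚ V] (B : V →ₗ[ℚ] V →ₗ[ℚ] ℚ)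
    (A N : Submodule ℤ V) : Prop where
  left : IsPosDefUnimodular B A
  right : IsPosDefUnimodular B N
  even : ∀ x ∈ N, ∃ n : ℤ, B x x = 2 * n
  mem_of_even : ∀ x ∈ A, (∃ n : ℤ, B x x = 2 * n) → x ∈ N

namespace IsEvenNeighbor

open Module Complex
open scoped Real

variable {V : Type*} [AddCommGroup V] [Module ℚ V] {B : V →ₗ[ℚ] V →ₗ[ℚ] ℚ}
  {A N N₁ N₂ : Submodule ℤ V}

theorem even_or_odd (h : IsEvenNeighbor B A N) {x : V} (hx : x ∈ A) :
    (∃ n : ℤ, B x x = 2 * n) ∨ ∃ n : ℤ, B x x = 2 * n + 1 := by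
  obtain ⟨n, hn⟩ := h.left.integral x hx x hx
  rcases Int.even_or_odd' n with ⟨k, rfl | rfl⟩
  · exact Or.inl ⟨k, by rw [hn]; push_cast; ring⟩
  · exact Or.inr ⟨k, by rw [hn]; push_cast; ring⟩

theorem notMem_of_odd (h : IsEvenNeighbor B A N) {x : V} (hx : ∃ n : ℤ, B x x = 2 * n + 1) :
    x ∉ N := fun hN => by
  obtain ⟨n, hn⟩ := hx
  obtain ⟨m, hm⟩ := h.even x hN
  rw [hm] at hn
  have : 2 * m = 2 * n + 1 := by exact_mod_cast hn
  omega

theorem apply_int (h : IsEvenNeighbor B A N) {s y : V} (hs : s ∈ N) (hy : y ∈ A)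
    (hye : ∃ n : ℤ, B y y = 2 * n) : ∃ n : ℤ, B s y = n :=
  h.right.integral s hs y (h.mem_of_even y hy hye)

/-- The product of a vector of an even neighbor outside `A` and an odd vector of `A`. -/
theorem apply_half (h : IsEvenNeighbor B A N) {s o : V} (hs : s ∈ N) (hsA : s ∉ A)
    (ho : o ∈ A) (hoo : ∃ n : ℤ, B o o = 2 * n + 1) : ∃ n : ℤ, 2 * B s o = 2 * n + 1 := by
  obtain ⟨k, hk⟩ := hoo
  obtain ⟨m, hm⟩ := h.apply_int hs (A.add_mem ho ho) ⟨2 * (2 * k + 1), by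
    simp only [map_add, LinearMap.add_apply, hk]; push_cast; ring⟩
  rw [map_add, ← two_mul] at hm
  rcases Int.even_or_odd' m with ⟨j, rfl | rfl⟩
  · refine absurd (h.left.mem_of_integral s fun y hy => ?_) hsA
    rcases h.even_or_odd hy with he | ⟨l, hl⟩
    · exact h.apply_int hs hy he
    · obtain ⟨p, hp⟩ := h.left.integral y hy o ho
      obtain ⟨i, hi⟩ := h.apply_int hs (A.sub_mem hy ho) ⟨l + k + 1 - p, by
        simp only [map_sub, LinearMap.sub_apply, h.left.symm o y, hl, hk, hp]; push_cast; ring⟩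
      refine ⟨i + j, ?_⟩
      rw [map_sub] at hi
      push_cast at hm ⊢
      linarith
  · exact ⟨j, by rw [hm]; push_cast; ring⟩

theorem add_mem (h₁ : IsEvenNeighbor B A N₁) (h₂ : IsEvenNeighbor B A N₂) {s t : V}
    (hs : s ∈ N₁) (hsA : s ∉ A) (ht : t ∈ N₂) (htA : t ∉ A) : s + t ∈ A := by
  refine h₁.left.mem_of_integral _ fun y hy => ?_
  rw [map_add, LinearMap.add_apply]
  rcases h₁.even_or_odd hy with he | ho
  · obtain ⟨n, hn⟩ := h₁.apply_int hs hy he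
    obtain ⟨m, hm⟩ := h₂.apply_int ht hy he
    exact ⟨n + m, by rw [hn, hm]; push_cast; ring⟩
  · obtain ⟨n, hn⟩ := h₁.apply_half hs hsA hy ho
    obtain ⟨m, hm⟩ := h₂.apply_half ht htA hy ho
    exact ⟨n + m + 1, by push_cast; linarith⟩

theorem sub_mem (h : IsEvenNeighbor B A N) {s t : V} (hs : s ∈ N) (hsA : s ∉ A) (ht : t ∈ N)
    (htA : t ∉ A) : s - t ∈ A :=
  sub_eq_add_neg s t ▸ h.add_mem h hs hsA (N.neg_mem ht) (mt A.neg_mem_iff.mp htA)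

theorem add_odd (h₁ : IsEvenNeighbor B A N₁) (h₂ : IsEvenNeighbor B A N₂) (hne : N₁ ≠ N₂)
    {s t : V} (hs : s ∈ N₁) (hsA : s ∉ A) (ht : t ∈ N₂) (htA : t ∉ A) :
    ∃ n : ℤ, B (s + t) (s + t) = 2 * n + 1 := by
  have hst := h₁.add_mem h₂ hs hsA ht htA
  refine (h₁.even_or_odd hst).resolve_left fun he => hne ?_
  have ht1 : t ∈ N₁ := by
    have := N₁.sub_mem (h₁.mem_of_even _ hst he) hs
    rwa [add_sub_cancel_left] at this
  have hle : N₂ ≤ N₁ := fun x hx => by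
    by_cases hxA : x ∈ A
    · exact h₁.mem_of_even x hxA (h₂.even x hx)
    · have := h₁.mem_of_even _ (h₂.sub_mem hx hxA ht htA) (h₂.even _ (N₂.sub_mem hx ht))
      have := N₁.add_mem this ht1
      rwa [sub_add_cancel] at this
  exact le_antisymm
    (fun x hx => h₂.right.mem_of_integral x fun y hy => h₁.right.integral x hx y (hle hy)) hle

theorem exists_notMem (h : IsEvenNeighbor B A N) (hodd : ∃ x ∈ A, ∃ n : ℤ, B x x = 2 * n + 1) :
    ∃ x ∈ N, x ∉ A := by
  by_contra! hle
  obtain ⟨o, ho, hoo⟩ := hodd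
  exact h.notMem_of_odd hoo
    (h.right.mem_of_integral o fun y hy => h.left.integral o ho y (hle y hy))

theorem three_le_of_odd (h : IsEvenNeighbor B A N) (hno1 : ∀ x ∈ A, B x x ≠ 1) {x : V}
    (hx : x ∈ A) (hxo : ∃ n : ℤ, B x x = 2 * n + 1) : 3 ≤ B x x := by
  obtain ⟨n, hn⟩ := hxo
  have h0 := h.left.nonneg x
  have h1 := hno1 x hx
  rw [hn] at h0 h1 ⊢
  have h2 : 0 ≤ 2 * n + 1 := by exact_mod_cast h0
  have h3 : n ≠ 0 := by rintro rfl; simp at h1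
  have h4 : 3 ≤ 2 * n + 1 := by omega
  exact_mod_cast h4

theorem apply_root_sq (h₁ : IsEvenNeighbor B A N₁) (h₂ : IsEvenNeighbor B A N₂) (hne : N₁ ≠ N₂)
    (hno1 : ∀ x ∈ A, B x x ≠ 1) {s t : V} (hs : s ∈ N₁) (hsA : s ∉ A) (hs2 : B s s = 2)
    (ht : t ∈ N₂) (htA : t ∉ A) (ht2 : B t t = 2) : B s t ^ 2 = 1 / 4 := by
  have hp := h₁.three_le_of_odd hno1 (h₁.add_mem h₂ hs hsA ht htA) (h₁.add_odd h₂ hne hs hsA ht htA)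
  have hm := h₁.three_le_of_odd hno1
    (h₁.add_mem h₂ hs hsA (N₂.neg_mem ht) (mt A.neg_mem_iff.mp htA))
    (h₁.add_odd h₂ hne hs hsA (N₂.neg_mem ht) (mt A.neg_mem_iff.mp htA))
  obtain ⟨n, hn⟩ := h₁.add_odd h₂ hne hs hsA ht htA
  simp only [map_add, map_neg, LinearMap.add_apply, LinearMap.neg_apply, h₁.left.symm t s, hs2,
    ht2] at hp hm hn
  have h1 : (1 : ℚ) ≤ n := by linarith
  have h2 : (n : ℚ) ≤ 2 := by linarith
  have h3 : 1 ≤ n := by exact_mod_cast h1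
  have h4 : n ≤ 2 := by exact_mod_cast h2
  rcases (by omega : n = 1 ∨ n = 2) with rfl | rfl
  · rw [show B s t = -1 / 2 by push_cast at hn; linarith]; norm_num
  · rw [show B s t = 1 / 2 by push_cast at hn; linarith]; norm_num

/-- The roots of an even neighbor that do not lie in the odd lattice. -/
noncomputable def newRoots [FiniteDimensional ℚ V] (h : IsEvenNeighbor B A N) : Finset V :=
  open Classical in (h.right.finite_norm_eq 2).toFinset.filter (· ∉ A)

variable [FiniteDimensional ℚ V]

theorem mem_newRoots (h : IsEvenNeighbor B A N) {s : V} :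
    s ∈ h.newRoots ↔ (s ∈ N ∧ B s s = 2) ∧ s ∉ A := by
  simp [newRoots]

theorem sum_roots_eq {M : Type*} [AddCommMonoid M] (h : IsEvenNeighbor B A N) (g : V → M) :
    ∑ r ∈ (h.right.finite_norm_eq 2).toFinset, g r =
      ∑ r ∈ (h.left.finite_norm_eq 2).toFinset, g r + ∑ s ∈ h.newRoots, g s := by
  classical
  rw [newRoots, ← Finset.sum_filter_add_sum_filter_not _ (· ∈ A)]
  congr 2
  ext r
  simp only [Finset.mem_filter, Set.Finite.mem_toFinset, Set.mem_ofPred_eq]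
  exact ⟨fun hr => ⟨hr.2, hr.1.2⟩,
    fun hr => ⟨⟨h.mem_of_even r hr.1 ⟨1, by rw [hr.2]; norm_num⟩, hr.2⟩, hr.1⟩⟩

theorem card_roots_eq (h : IsEvenNeighbor B A N) :
    (h.right.finite_norm_eq 2).toFinset.card =
      (h.left.finite_norm_eq 2).toFinset.card + h.newRoots.card := by
  simpa only [Finset.card_eq_sum_ones] using h.sum_roots_eq (fun _ => 1)

theorem tsum_ite_add_norm_eq_two (h₁ : IsEvenNeighbor B A N₁) (h₂ : IsEvenNeighbor B A N₂)
    (hne : N₁ ≠ N₂) {v : V} (hv : v ∈ N₂) (hvA : v ∉ A) :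
    ∑' x : N₁, (if (B (x + v) (x + v) : ℝ) = 2 then (1 : ℂ) else 0) = h₂.newRoots.card := by
  classical
  rw [show (fun x : N₁ => if (B (x + v) (x + v) : ℝ) = 2 then (1 : ℂ) else 0) =
      fun x : N₁ => if (x : V) + v ∈ h₂.newRoots then (1 : ℂ) else 0 from ?_]
  · have hinj : Function.Injective fun x : N₁ => (x : V) + v :=
      fun _ _ hxy => Subtype.ext (add_right_cancel hxy)
    rw [tsum_eq_sum (s := h₂.newRoots.preimage (fun x : N₁ => (x : V) + v) hinj.injOn)]
    · rw [Finset.sum_ite_of_true fun x hx => Finset.mem_preimage.mp hx, Finset.sum_const,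
        nsmul_eq_mul, mul_one, Nat.cast_inj]
      refine Finset.card_nbij (fun x => (x : V) + v)
        (fun x hx => by simpa using hx)
        hinj.injOn fun t ht => ?_
      obtain ⟨⟨ht1, ht2⟩, htA⟩ := h₂.mem_newRoots.mp ht
      have hd := h₁.mem_of_even _ (h₂.sub_mem ht1 htA hv hvA) (h₂.even _ (N₂.sub_mem ht1 hv))
      exact ⟨⟨t - v, hd⟩, by simpa using ht, sub_add_cancel t v⟩
    · intro x hx
      exact if_neg fun h => hx (Finset.mem_preimage.mpr h)
  · funext x
    refine if_congr ?_ rfl rfl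
    rw [h₂.mem_newRoots]
    constructor
    · intro hx
      have hx2 : B (x + v) (x + v) = 2 := by exact_mod_cast hx
      have hxA : (x : V) ∈ A := by
        by_contra hxA
        exact h₁.notMem_of_odd (h₁.add_odd h₂ hne x.2 hxA hv hvA) (h₁.mem_of_even _
          (h₁.add_mem h₂ x.2 hxA hv hvA) ⟨1, by rw [hx2]; norm_num⟩)
      exact ⟨⟨N₂.add_mem (h₂.mem_of_even x hxA (h₁.even x x.2)) hv, hx2⟩,
        fun hA => hvA ((A.add_mem_iff_right hxA).mp hA)⟩
    · intro hx
      rw [hx.1.2]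
      norm_num

/-- The relation between the numbers of roots of an odd unimodular lattice of rank 24 and of
its even neighbors. -/
theorem card_roots_add_eq (h₁ : IsEvenNeighbor B A N₁) (h₂ : IsEvenNeighbor B A N₂)
    (hne : N₁ ≠ N₂) (hr : finrank ℚ V = 24) (hno1 : ∀ x ∈ A, B x x ≠ 1)
    (hodd : ∃ x ∈ A, ∃ n : ℤ, B x x = 2 * n + 1) :
    (h₁.left.finite_norm_eq 2).toFinset.card + 48 = h₁.newRoots.card + h₂.newRoots.card := by
  obtain ⟨v, hv, hvA⟩ := h₂.exists_notMem hodd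
  have hA : ∑ r ∈ (h₁.left.finite_norm_eq 2).toFinset, cexp (2 * π * I * (B r v : ℝ)) =
      ∑ r ∈ (h₁.left.finite_norm_eq 2).toFinset, 1 := by
    refine Finset.sum_congr rfl fun r hr => ?_
    obtain ⟨hrA, hr2⟩ := (h₁.left.finite_norm_eq 2).mem_toFinset.mp hr
    obtain ⟨n, hn⟩ := h₂.apply_int hv hrA ⟨1, by rw [hr2]; norm_num⟩
    rw [h₁.left.symm r v, hn, ← Complex.exp_int_mul_two_pi_mul_I n]
    congr 1
    push_cast
    ring
  have hS : ∑ s ∈ h₁.newRoots, cexp (2 * π * I * (B s v : ℝ)) = ∑ s ∈ h₁.newRoots, -1 := by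
    refine Finset.sum_congr rfl fun s hs => ?_
    obtain ⟨⟨hs1, hs2⟩, hsA⟩ := h₁.mem_newRoots.mp hs
    obtain ⟨n, hn⟩ := h₁.add_odd h₂ hne hs1 hsA hv hvA
    obtain ⟨m, hm⟩ := h₂.even v hv
    simp only [map_add, LinearMap.add_apply, h₁.left.symm v s, hs2, hm] at hn
    have hsv : B s v = (n - m - 1 : ℤ) + 1 / 2 := by push_cast; linarith
    rw [hsv, ← Complex.exp_pi_mul_I, ← mul_one (cexp (π * I)),
      ← Complex.exp_int_mul_two_pi_mul_I (n - m - 1), ← Complex.exp_add]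
    congr 1
    push_cast
    ring
  have key := h₁.right.sum_roots_cexp_eq hr h₁.even (v := v) fun x hx => ?_
  · rw [h₁.tsum_ite_add_norm_eq_two h₂ hne hv hvA, h₁.sum_roots_eq, hA, hS] at key
    simp only [Finset.sum_const, nsmul_eq_mul] at key
    have : ((h₁.left.finite_norm_eq 2).toFinset.card : ℂ) + 48 =
        h₁.newRoots.card + h₂.newRoots.card := by linear_combination key
    exact_mod_cast this
  · by_cases hxA : x ∈ A
    · obtain ⟨n, hn⟩ := h₂.even _ (N₂.add_mem (h₂.mem_of_even x hxA (h₁.even x hx)) hv)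
      have h0 : x + v ≠ 0 := fun h0 =>
        hvA (eq_neg_of_add_eq_zero_right h0 ▸ A.neg_mem hxA)
      have hp := h₁.left.pos _ h0
      refine ⟨2 * n, by rw [hn]; push_cast; ring, ?_⟩
      rw [hn] at hp
      have : 0 < 2 * n := by exact_mod_cast hp
      omega
    · have hm := h₁.add_mem h₂ hx hxA hv hvA
      obtain ⟨n, hn⟩ := h₁.left.integral _ hm _ hm
      have hp := h₁.three_le_of_odd hno1 hm (h₁.add_odd h₂ hne hx hxA hv hvA)
      refine ⟨n, hn, ?_⟩
      rw [hn] at hp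
      have : 3 ≤ n := by exact_mod_cast hp
      omega

/-- The sum of the squared products of the roots of an odd unimodular lattice of rank 24. -/
theorem sum_roots_sq_eq (h₁ : IsEvenNeighbor B A N₁) (h₂ : IsEvenNeighbor B A N₂)
    (hne : N₁ ≠ N₂) (hr : finrank ℚ V = 24) (hno1 : ∀ x ∈ A, B x x ≠ 1) :
    6 * ∑ r ∈ (h₁.left.finite_norm_eq 2).toFinset, ∑ s ∈ (h₁.left.finite_norm_eq 2).toFinset,
        B r s ^ 2 =
      ((h₁.left.finite_norm_eq 2).toFinset.card : ℚ) ^ 2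
        + h₁.newRoots.card * h₂.newRoots.card / 2 := by
  have hv : ∀ {N : Submodule ℤ V} (h : IsEvenNeighbor B A N), ∀ w, B w w = 2 →
      6 * (∑ r ∈ (h.left.finite_norm_eq 2).toFinset, B w r ^ 2 +
        ∑ s ∈ h.newRoots, B w s ^ 2) =
      (h.left.finite_norm_eq 2).toFinset.card + h.newRoots.card := by
    intro N h w hw
    have := h.right.twelve_mul_sum_roots_sq hr h.even w
    rw [h.sum_roots_eq, h.card_roots_eq, hw] at this
    simp only [h.left.symm w]
    push_cast at this
    linarith
  have e1 := Finset.sum_congr rfl fun r hr =>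
    hv h₁ r ((h₁.left.finite_norm_eq 2).mem_toFinset.mp hr).2
  have e2 := Finset.sum_congr rfl fun s hs => hv h₂ s (h₁.mem_newRoots.mp hs).1.2
  have e3 : ∑ s ∈ h₁.newRoots, ∑ t ∈ h₂.newRoots, B s t ^ 2 =
      h₁.newRoots.card * h₂.newRoots.card / 4 := by
    rw [Finset.sum_congr rfl fun s hs => Finset.sum_congr rfl fun t ht =>
      h₁.apply_root_sq h₂ hne hno1 (h₁.mem_newRoots.mp hs).1.1 (h₁.mem_newRoots.mp hs).2
        (h₁.mem_newRoots.mp hs).1.2 (h₂.mem_newRoots.mp ht).1.1 (h₂.mem_newRoots.mp ht).2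
        (h₂.mem_newRoots.mp ht).1.2]
    simp only [Finset.sum_const, nsmul_eq_mul]
    ring
  have e4 : ∑ s ∈ h₁.newRoots, ∑ r ∈ (h₁.left.finite_norm_eq 2).toFinset, B s r ^ 2 =
      ∑ r ∈ (h₁.left.finite_norm_eq 2).toFinset, ∑ s ∈ h₁.newRoots, B r s ^ 2 := by
    rw [Finset.sum_comm]
    exact Finset.sum_congr rfl fun r _ => Finset.sum_congr rfl fun s _ => by rw [h₁.left.symm]
  simp only [← Finset.mul_sum, Finset.sum_add_distrib, Finset.sum_const, nsmul_eq_mul] at e1 e2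
  rw [e3, e4] at e2
  linarith

end IsEvenNeighbor

theorem IsPosDefUnimodular.of_pos_on {V : Type*} [AddCommGroup V] [Module ℚ V]
    {B : V →ₗ[ℚ] V →ₗ[ℚ] ℚ} {A : Submodule ℤ V} (hfg : A.FG)
    (hspan : Submodule.span ℚ (A : Set V) = ⊤) (hsymm : ∀ x y, B x y = B y x)
    (hpos : ∀ x ∈ A, x ≠ 0 → 0 < B x x) (hint : ∀ x ∈ A, ∀ y ∈ A, ∃ n : ℤ, B x y = n)
    (hunimod : ∀ v, (∀ y ∈ A, ∃ n : ℤ, B v y = n) → v ∈ A) : IsPosDefUnimodular B A := by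
  refine ⟨hfg, hspan, hsymm, fun x hx => ?_, hint, hunimod⟩
  have : IsAddTorsionFree V := .of_module_rat _
  obtain ⟨m, hm, hmx⟩ : ∃ m : ℤ, m ≠ 0 ∧ m • x ∈ A := by
    have hx' : x ∈ Submodule.span ℚ (A : Set V) := hspan ▸ Submodule.mem_top
    clear hx
    induction hx' using Submodule.span_induction with
    | mem x h => exact ⟨1, one_ne_zero, by simpa using h⟩
    | zero => exact ⟨1, one_ne_zero, by simp⟩
    | add x y _ _ h1 h2 =>
      obtain ⟨m, hm, hmx⟩ := h1
      obtain ⟨n, hn, hny⟩ := h2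
      refine ⟨m * n, mul_ne_zero hm hn, ?_⟩
      rw [smul_add, mul_comm, mul_smul, mul_comm, mul_smul]
      exact A.add_mem (A.smul_mem n hmx) (A.smul_mem m hny)
    | smul a x _ h =>
      obtain ⟨m, hm, hmx⟩ := h
      refine ⟨m * a.den, mul_ne_zero hm (by exact_mod_cast a.den_ne_zero), ?_⟩
      have := A.smul_mem a.num hmx
      rw [← Int.cast_smul_eq_zsmul ℚ, ← Int.cast_smul_eq_zsmul ℚ, smul_smul] at this
      rw [← Int.cast_smul_eq_zsmul ℚ, smul_smul]
      convert this using 2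
      push_cast
      rw [mul_assoc, mul_comm (a.den : ℚ), Rat.mul_den_eq_num, mul_comm]
  have h := hpos _ hmx (smul_ne_zero hm hx)
  rw [← Int.cast_smul_eq_zsmul ℚ, map_smul, map_smul, LinearMap.smul_apply, smul_eq_mul,
    smul_eq_mul, ← mul_assoc] at h
  exact pos_of_mul_pos_right h (mul_self_nonneg _)

/-- Let `A` be an odd positive definite unimodular lattice of rank 24 with no vectors of
norm 1, with even neighbors `N₁ ≠ N₂` of Coxeter numbers `h₁, h₂`, and let `ρ` be the Weyl
vector of `A`.  Then `B(ρ,ρ) = h₁·h₂` and `A` has `8(h₁ + h₂ − 2)` roots. -/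
theorem odd24_weyl_norm_eq_product_of_neighbor_coxeter_numbers
    (V : Type*) [AddCommGroup V] [Module ℚ V]
    (A : Submodule ℤ V) (hfg : A.FG)
    (hspan : Submodule.span ℚ (A : Set V) = ⊤)
    (hrank : Module.finrank ℚ V = 24)
    (B : V →ₗ[ℚ] V →ₗ[ℚ] ℚ)
    (hsymm : ∀ x y : V, B x y = B y x)
    (hint : ∀ x ∈ A, ∀ y ∈ A, ∃ n : ℤ, B x y = (n : ℚ))
    (hpos : ∀ x ∈ A, x ≠ 0 → 0 < B x x)
    (hunimod : ∀ v : V, (∀ y ∈ A, ∃ n : ℤ, B v y = (n : ℚ)) → v ∈ A)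
    (hodd : ∃ x ∈ A, ∃ n : ℤ, B x x = 2 * (n : ℚ) + 1)
    (hno1 : ∀ x ∈ A, B x x ≠ 1)
    (N₁ N₂ : Submodule ℤ V) (hNne : N₁ ≠ N₂)
    (hN : ∀ N ∈ ({N₁, N₂} : Set (Submodule ℤ V)),
      N.FG ∧ Submodule.span ℚ (N : Set V) = ⊤ ∧
      (∀ x ∈ N, ∀ y ∈ N, ∃ n : ℤ, B x y = (n : ℚ)) ∧
      (∀ x ∈ N, ∃ n : ℤ, B x x = 2 * (n : ℚ)) ∧
      (∀ v : V, (∀ y ∈ N, ∃ n : ℤ, B v y = (n : ℚ)) → v ∈ N) ∧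
      (∀ x ∈ A, (∃ n : ℤ, B x x = 2 * (n : ℚ)) → x ∈ N))
    (h₁ h₂ : ℚ)
    (hh₁ : h₁ = ({r : V | r ∈ N₁ ∧ B r r = 2}.ncard : ℚ) / 24)
    (hh₂ : h₂ = ({r : V | r ∈ N₂ ∧ B r r = 2}.ncard : ℚ) / 24)
    (f : V →ₗ[ℚ] ℚ)
    (hf : ∀ x ∈ A, B x x = 2 → f x ≠ 0)
    (ρ : V)
    (hρ : ρ = (2⁻¹ : ℚ) • ∑ᶠ x ∈ {x : V | x ∈ A ∧ B x x = 2 ∧ 0 < f x}, x) :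
    B ρ ρ = h₁ * h₂ ∧
    ({r : V | r ∈ A ∧ B r r = 2}.ncard : ℚ) = 8 * (h₁ + h₂ - 2) := by
  have hfin : FiniteDimensional ℚ V := .of_finrank_pos (by omega)
  have hA := IsPosDefUnimodular.of_pos_on hfg hspan hsymm hpos hint hunimod
  have hnb : ∀ N ∈ ({N₁, N₂} : Set (Submodule ℤ V)), IsEvenNeighbor B A N := fun N hNm => by
    obtain ⟨a, b, c, d, e, g⟩ := hN N hNm
    exact ⟨hA, ⟨a, b, hsymm, hA.pos, c, e⟩, d, g⟩
  have hN₁ := hnb N₁ (by simp)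
  have hN₂ := hnb N₂ (by simp)
  have hmem : ∀ r, r ∈ (hA.finite_norm_eq 2).toFinset ↔ r ∈ A ∧ B r r = 2 := fun r =>
    (hA.finite_norm_eq 2).mem_toFinset
  have hsum : ∑ᶠ x ∈ {x : V | x ∈ A ∧ B x x = 2 ∧ 0 < f x}, x =
      ∑ r ∈ (hA.finite_norm_eq 2).toFinset with 0 < f r, r := by
    rw [← finsum_mem_coe_finset]
    congr! 3
    simp [and_assoc]
  have hweyl := weyl_norm_eq (R := (hA.finite_norm_eq 2).toFinset) (f := f) hsymm hA.pos
    (fun r hr => ((hmem r).mp hr).2)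
    (fun r hr s hs => hint r ((hmem r).mp hr).1 s ((hmem s).mp hs).1)
    (fun r hr => (hmem _).mpr ⟨A.neg_mem ((hmem r).mp hr).1, by simpa using ((hmem r).mp hr).2⟩)
    (fun r hr s hs hrs => (hmem _).mpr ⟨A.sub_mem ((hmem r).mp hr).1 ((hmem s).mp hs).1, by
      simp only [map_sub, LinearMap.sub_apply, hsymm s r, hrs, ((hmem r).mp hr).2,
        ((hmem s).mp hs).2]
      norm_num⟩)
    (fun r hr => hf r ((hmem r).mp hr).1 ((hmem r).mp hr).2) (hsum ▸ hρ)
  have hsq := hN₁.sum_roots_sq_eq hN₂ hNne hrank hno1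
  have hcount : ((hA.finite_norm_eq 2).toFinset.card : ℚ) + 48 =
      hN₁.newRoots.card + hN₂.newRoots.card := by
    exact_mod_cast hN₁.card_roots_add_eq hN₂ hNne hrank hno1 hodd
  rw [Set.ncard_eq_toFinset_card _ (hN₁.right.finite_norm_eq 2), hN₁.card_roots_eq,
    Nat.cast_add] at hh₁
  rw [Set.ncard_eq_toFinset_card _ (hN₂.right.finite_norm_eq 2), hN₂.card_roots_eq,
    Nat.cast_add] at hh₂
  rw [Set.ncard_eq_toFinset_card _ (hA.finite_norm_eq 2), hh₁, hh₂]
  generalize ((hA.finite_norm_eq 2).toFinset.card : ℚ) = n at *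
  generalize (hN₁.newRoots.card : ℚ) = a at *
  obtain rfl : n = a + hN₂.newRoots.card - 48 := by linarith
  constructor
  · linear_combination hweyl / 48 + hsq / 288
  · ring
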